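/- Consider the true FIR SISO plant of order r with coefficient vector g, and let Θ₀ = {R₀, M₀, N₀, L₀} be a minimizer of J(g, Θ) over all system responses Θ satisfying the SLS constraints for (Z, e₁, gᵀ). Let g̃ be the coarse-grained identification estimate of g obtained from m experiments whose inputs u_i each satisfy ‖u_i‖_p ≤ 1 and are chosen so that S := ((Z_matᵀZ_mat)⁻¹)_{[r]} satisfies Tr(S) ≤ 4·log 2·r^{2/max(p,2)}/m, and let (Θ̃*, α*) be a minimizer of the robust SLS problem for g̃ with uncertainty parameter ε := 2·√(log 2 · σ²·r^{2/max(p,2)}/m)·(1 + √(2·log(1/η))). If ε < 1/(4‖N₀‖), then with probability at least 1 − η over the experiment noise: the controller K̃* = L̃* − M̃*·R̃*⁻¹·Ñ* internally stabilizes the true plant (Z, e₁, gᵀ), and the closed-loop response Θ̂* that it achieves on the true plant satisfies J(g, Θ̂*) − J(g, Θ₀) ≤ 8·√(log 2 · σ²·r^{2/max(p,2)}/m)·(1 + √(2·log(1/η)))·‖[1 + gᵀN₀; L₀]‖·‖R₀B₁ + N₀D₂₁‖. -/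

import Mathlib

/- Preliminaries: transfer functions as real rational functions, RH∞, H∞ norms,
   System-Level Synthesis (SLS) constraints, controllers, closed-loop responses,
   coarse-grained identification, Gaussian vectors. -/

noncomputable section
open scoped Matrix BigOperators ENNReal
open MeasureTheory ProbabilityTheory Polynomial

namespace SLS

/-- Scalar transfer functions: real rational functions in `z`. -/
abbrev TF : Type := RatFunc ℝ

/-- Transfer matrices. -/
abbrev TMat (m n : ℕ) : Type := Matrix (Fin m) (Fin n) TF

/-- Embed a real matrix as a (constant) transfer matrix. -/
def rmap {m n : ℕ} (A : Matrix (Fin m) (Fin n) ℝ) : TMat m n := A.map RatFunc.C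

/-- Evaluate a scalar transfer function at a complex point. -/
def evalTF (f : TF) (z : ℂ) : ℂ :=
  (f.num.map (algebraMap ℝ ℂ)).eval z / (f.denom.map (algebraMap ℝ ℂ)).eval z

/-- Evaluate a transfer matrix at a complex point. -/
def evalMat {m n : ℕ} (F : TMat m n) (z : ℂ) : Matrix (Fin m) (Fin n) ℂ :=
  Matrix.of fun i j => evalTF (F i j) z

/-- Spectral norm (ℓ2 → ℓ2 operator norm) of a matrix over `ℝ` or `ℂ`. -/
def specNorm {𝕜 : Type} [RCLike 𝕜] {m n : ℕ} (M : Matrix (Fin m) (Fin n) 𝕜) : ℝ :=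
  ‖LinearMap.toContinuousLinearMap (Matrix.toEuclideanLin M)‖

/-- H∞ norm of a transfer matrix: sup over the unit circle of the spectral norm. -/
def hinfNorm {m n : ℕ} (F : TMat m n) : ℝ :=
  sSup {x : ℝ | ∃ z : ℂ, ‖z‖ = 1 ∧ x = specNorm (evalMat F z)}

/-- H∞ norm of a scalar transfer function. -/
def hinfNormTF (f : TF) : ℝ :=
  sSup {x : ℝ | ∃ z : ℂ, ‖z‖ = 1 ∧ x = ‖evalTF f z‖}

/-- A scalar transfer function is proper if its numerator degree does not exceed
its denominator degree. -/
def ProperTF (f : TF) : Prop := f.num.degree ≤ f.denom.degree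

/-- Strictly proper: vanishes at `z = ∞`. -/
def StrictlyProperTF (f : TF) : Prop := f.num.degree < f.denom.degree

/-- Stable: all poles lie strictly inside the open unit disk. -/
def StableTF (f : TF) : Prop :=
  ∀ z : ℂ, (f.denom.map (algebraMap ℝ ℂ)).eval z = 0 → ‖z‖ < 1

/-- Membership in RH∞ for scalar transfer functions: proper and stable. -/
def MemRHinfTF (f : TF) : Prop := ProperTF f ∧ StableTF f

/-- Membership in RH∞ for transfer matrices (entrywise). -/
def MemRHinf {m n : ℕ} (F : TMat m n) : Prop := ∀ i j, MemRHinfTF (F i j)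

/-- Strict properness of a transfer matrix (entrywise). -/
def StrictlyProper {m n : ℕ} (F : TMat m n) : Prop := ∀ i j, StrictlyProperTF (F i j)

/-- The transfer matrix `zI - A` for a real matrix `A`. -/
def zIA {n : ℕ} (A : Matrix (Fin n) (Fin n) ℝ) : TMat n n :=
  Matrix.diagonal (fun _ => (RatFunc.X : TF)) - rmap A

/-- A system response `Θ = {R, M, N, L}` for a plant with `n` states, `p` control
inputs and `q` measured outputs. -/
structure Response (n p q : ℕ) where
  R : TMat n n
  M : TMat p n
  N : TMat n q
  L : TMat p q

/-- The stability part of the SLS constraints: `R, M, N` strictly proper in RH∞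
and `L ∈ RH∞`. -/
def SLSStable {n p q : ℕ} (Θ : Response n p q) : Prop :=
  StrictlyProper Θ.R ∧ StrictlyProper Θ.M ∧ StrictlyProper Θ.N ∧
  MemRHinf Θ.R ∧ MemRHinf Θ.M ∧ MemRHinf Θ.N ∧ MemRHinf Θ.L

/-- The SLS constraints for the plant `(A, B₂, C₂)`:
`[zI − A, −B₂]·[[R, N],[M, L]] = [I, 0]`, `[[R, N],[M, L]]·[zI − A; −C₂] = [I; 0]`,
written blockwise, together with the stability conditions. -/
def SLSConstraints {n p q : ℕ} (A : Matrix (Fin n) (Fin n) ℝ)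
    (B₂ : Matrix (Fin n) (Fin p) ℝ) (C₂ : Matrix (Fin q) (Fin n) ℝ)
    (Θ : Response n p q) : Prop :=
  zIA A * Θ.R - rmap B₂ * Θ.M = 1 ∧
  zIA A * Θ.N - rmap B₂ * Θ.L = 0 ∧
  Θ.R * zIA A - Θ.N * rmap C₂ = 1 ∧
  Θ.M * zIA A - Θ.L * rmap C₂ = 0 ∧
  SLSStable Θ

/-- The robust SLS constraints with perturbations `(Δ₁, Δ₂)`: the second block
equation becomes `[[R, N],[M, L]]·[zI − A; −C₂] = [I + Δ₁; Δ₂]`. -/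
def RobustSLSConstraints {n p q : ℕ} (A : Matrix (Fin n) (Fin n) ℝ)
    (B₂ : Matrix (Fin n) (Fin p) ℝ) (C₂ : Matrix (Fin q) (Fin n) ℝ)
    (Δ₁ : TMat n n) (Δ₂ : TMat p n) (Θ : Response n p q) : Prop :=
  zIA A * Θ.R - rmap B₂ * Θ.M = 1 ∧
  zIA A * Θ.N - rmap B₂ * Θ.L = 0 ∧
  Θ.R * zIA A - Θ.N * rmap C₂ = 1 + Δ₁ ∧
  Θ.M * zIA A - Θ.L * rmap C₂ = Δ₂ ∧
  SLSStable Θ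

/-- The controller `K = L − M R⁻¹ N` induced by a system response. -/
def controller {n p q : ℕ} (Θ : Response n p q) : TMat p q :=
  Θ.L - Θ.M * Θ.R⁻¹ * Θ.N

/-- `K` achieves the closed-loop response `Θ'` on the plant `(A, B₂, C₂)`: in the
feedback loop `x = (zI − A)⁻¹(B₂u + δx)`, `y = C₂x + δy`, `u = Ky`, the transfer
matrices from `(δx, δy)` to `(x, u)` equal `[[R', N'],[M', L']]`. -/
def Achieves {n p q : ℕ} (A : Matrix (Fin n) (Fin n) ℝ)
    (B₂ : Matrix (Fin n) (Fin p) ℝ) (C₂ : Matrix (Fin q) (Fin n) ℝ)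
    (K : TMat p q) (Θ' : Response n p q) : Prop :=
  zIA A * Θ'.R = rmap B₂ * Θ'.M + 1 ∧
  zIA A * Θ'.N = rmap B₂ * Θ'.L ∧
  Θ'.M = K * rmap C₂ * Θ'.R ∧
  Θ'.L = K * rmap C₂ * Θ'.N + K

/-- `K` internally stabilizes the plant `(A, B₂, C₂)`: the four closed-loop
transfer matrices exist, `R', M', N'` are strictly proper, and all four lie in RH∞. -/
def InternallyStabilizes {n p q : ℕ} (A : Matrix (Fin n) (Fin n) ℝ)
    (B₂ : Matrix (Fin n) (Fin p) ℝ) (C₂ : Matrix (Fin q) (Fin n) ℝ)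
    (K : TMat p q) : Prop :=
  ∃ Θ' : Response n p q, Achieves A B₂ C₂ K Θ' ∧ SLSStable Θ'

/-! ### FIR SISO plants -/

/-- The down-shift matrix (ones on the subdiagonal). -/
def shiftMat (n : ℕ) : Matrix (Fin n) (Fin n) ℝ :=
  Matrix.of fun i j => if (i : ℕ) = (j : ℕ) + 1 then 1 else 0

/-- The first standard basis vector, as a column matrix. -/
def e1 (n : ℕ) : Matrix (Fin n) (Fin 1) ℝ :=
  Matrix.of fun i _ => if (i : ℕ) = 0 then 1 else 0

/-- A vector as a row matrix (`gᵀ`). -/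
def rowVec {n : ℕ} (g : Fin n → ℝ) : Matrix (Fin 1) (Fin n) ℝ :=
  Matrix.of fun _ j => g j

/-- The matrix `C₁ = [gᵀ; 0]`. -/
def C1mat {n : ℕ} (g : Fin n → ℝ) : Matrix (Fin 2) (Fin n) ℝ :=
  Matrix.of fun i j => if (i : ℕ) = 0 then g j else 0

/-- The matrix `D₁₂ = [0; 1]`. -/
def D12mat : Matrix (Fin 2) (Fin 1) ℝ :=
  Matrix.of fun i _ => if (i : ℕ) = 1 then 1 else 0

/-- Stack two scalar transfer functions into a 2×1 transfer matrix `[a; b]`. -/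
def col2 (a b : TF) : TMat 2 1 :=
  Matrix.of fun i _ => if (i : ℕ) = 0 then a else b

/-- The H∞ cost `J(g, Θ) = ‖[C₁, D₁₂]·[[R, N],[M, L]]·[B₁; D₂₁] + D₁₁‖` of a
system response for the generalized plant built from FIR coefficients `g`. -/
def cost {n nw : ℕ} (g : Fin n → ℝ) (B₁ : Matrix (Fin n) (Fin nw) ℝ)
    (D₂₁ : Matrix (Fin 1) (Fin nw) ℝ) (D₁₁ : Matrix (Fin 2) (Fin nw) ℝ)
    (Θ : Response n 1 1) : ℝ :=
  hinfNorm ((rmap (C1mat g) * Θ.R + rmap D12mat * Θ.M) * rmap B₁ +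
    (rmap (C1mat g) * Θ.N + rmap D12mat * Θ.L) * rmap D₂₁ + rmap D₁₁)

/-- The transfer matrix `[1 + g̃ᵀÑ; L̃]` and its H∞ norm. -/
def perfWeight {n : ℕ} (g : Fin n → ℝ) (Θ : Response n 1 1) : ℝ :=
  hinfNorm (col2 (1 + (rmap (rowVec g) * Θ.N) 0 0) (Θ.L 0 0))

/-- The robust SLS objective `Q(g̃, Θ̃, α) = J(g̃, Θ̃) + εα‖R̃B₁ + ÑD₂₁‖`. -/
def Qval {n nw : ℕ} (g : Fin n → ℝ) (B₁ : Matrix (Fin n) (Fin nw) ℝ)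
    (D₂₁ : Matrix (Fin 1) (Fin nw) ℝ) (D₁₁ : Matrix (Fin 2) (Fin nw) ℝ)
    (ε : ℝ) (Θ : Response n 1 1) (α : ℝ) : ℝ :=
  cost g B₁ D₂₁ D₁₁ Θ + ε * α * hinfNorm (Θ.R * rmap B₁ + Θ.N * rmap D₂₁)

/-- Feasibility for the robust SLS problem for the estimate `g̃` with uncertainty
parameter `ε`: `α > 0`, `Θ̃` satisfies the SLS constraints for `(Z, e₁, g̃ᵀ)`, and
`εα‖Ñ‖ + ‖[1 + g̃ᵀÑ; L̃]‖ ≤ α`. -/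
def RobustFeasible {n : ℕ} (g : Fin n → ℝ) (ε : ℝ) (Θ : Response n 1 1) (α : ℝ) : Prop :=
  0 < α ∧ SLSConstraints (shiftMat n) (e1 n) (rowVec g) Θ ∧
  ε * α * hinfNorm Θ.N + perfWeight g Θ ≤ α

/-- `(Θ̃, α)` is a minimizer of the robust SLS problem for `g̃`. -/
def RobustOptimal {n nw : ℕ} (g : Fin n → ℝ) (B₁ : Matrix (Fin n) (Fin nw) ℝ)
    (D₂₁ : Matrix (Fin 1) (Fin nw) ℝ) (D₁₁ : Matrix (Fin 2) (Fin nw) ℝ)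
    (ε : ℝ) (Θ : Response n 1 1) (α : ℝ) : Prop :=
  RobustFeasible g ε Θ α ∧
  ∀ Θ' α', RobustFeasible g ε Θ' α' → Qval g B₁ D₂₁ D₁₁ ε Θ α ≤ Qval g B₁ D₂₁ D₁₁ ε Θ' α'

/-- `Θ₀` is a minimizer of `J(g, ·)` over responses satisfying the SLS constraints
for the plant `(Z, e₁, gᵀ)`. -/
def OptimalResponse {n nw : ℕ} (g : Fin n → ℝ) (B₁ : Matrix (Fin n) (Fin nw) ℝ)
    (D₂₁ : Matrix (Fin 1) (Fin nw) ℝ) (D₁₁ : Matrix (Fin 2) (Fin nw) ℝ)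
    (Θ : Response n 1 1) : Prop :=
  SLSConstraints (shiftMat n) (e1 n) (rowVec g) Θ ∧
  ∀ Θ', SLSConstraints (shiftMat n) (e1 n) (rowVec g) Θ' →
    cost g B₁ D₂₁ D₁₁ Θ ≤ cost g B₁ D₂₁ D₁₁ Θ'

/-- The FIR transfer function `G(z) = Σ_{t=1}^{r−1} g_t z^{−t}` for
`g = (g₁, …, g_{r−1})`. -/
def firTF {n : ℕ} (g : Fin n → ℝ) : TF :=
  ∑ t : Fin n, RatFunc.C (g t) * (RatFunc.X)⁻¹ ^ ((t : ℕ) + 1)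

/-- The FIR transfer function `G(z) = Σ_{k=0}^{T−1} g_k z^{−k}` for a full
impulse-response vector `g_{0:T−1}`. -/
def firTF0 {T : ℕ} (g : Fin T → ℝ) : TF :=
  ∑ k : Fin T, RatFunc.C (g k) * (RatFunc.X)⁻¹ ^ (k : ℕ)

/-! ### Coarse-grained identification -/

/-- Euclidean (ℓ2) norm of a finite real vector. -/
def euclNorm {r : ℕ} (x : Fin r → ℝ) : ℝ := Real.sqrt (∑ i, x i ^ 2)

/-- ℓp norm of a finite real vector, `p ∈ [1, ∞]`. -/
def lpNorm {T : ℕ} (p : ℝ≥0∞) (x : Fin T → ℝ) : ℝ :=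
  if p = ∞ then ⨆ i, |x i| else (∑ i, |x i| ^ p.toReal) ^ (1 / p.toReal)

/-- `r^{2/max(p,2)}` as a real number. -/
def rExp (p : ℝ≥0∞) (r : ℕ) : ℝ := (r : ℝ) ^ ((2 / max p 2).toReal)

/-- The T×T lower-triangular Toeplitz matrix whose first column is `u`. -/
def toep {T : ℕ} (u : Fin T → ℝ) : Matrix (Fin T) (Fin T) ℝ :=
  Matrix.of fun i j =>
    if (j : ℕ) ≤ (i : ℕ) then u ⟨(i : ℕ) - (j : ℕ), lt_of_le_of_lt (Nat.sub_le _ _) i.isLt⟩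
    else 0

/-- The stacked input matrix `Z_mat = [Toep(u₁); …; Toep(u_m)]`. -/
def Zmat {T mE : ℕ} (u : Fin mE → Fin T → ℝ) : Matrix (Fin mE × Fin T) (Fin T) ℝ :=
  Matrix.of fun pr j => toep (u pr.1) pr.2 j

/-- `Z_matᵀ Z_mat`. -/
def ZtZ {T mE : ℕ} (u : Fin mE → Fin T → ℝ) : Matrix (Fin T) (Fin T) ℝ :=
  (Zmat u)ᵀ * Zmat u

/-- The least-squares estimate `g̃_{0:T−1} = (Z_matᵀZ_mat)⁻¹Z_matᵀ(y₁; …; y_m)`. -/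
def lsEst {T mE : ℕ} (u : Fin mE → Fin T → ℝ) (y : Fin mE → Fin T → ℝ) : Fin T → ℝ :=
  ((ZtZ u)⁻¹ * (Zmat u)ᵀ).mulVec fun pr => y pr.1 pr.2

/-- Pad the FIR coefficients `g = (g₁, …, g_{r−1})` to the impulse response
`g_{0:T−1} = (0, g₁, …, g_{r−1}, 0, …, 0)`. -/
def pad {r T : ℕ} (_ : r ≤ T) (g : Fin (r - 1) → ℝ) : Fin T → ℝ := fun k =>
  if hk : 1 ≤ (k : ℕ) ∧ (k : ℕ) < r then g ⟨(k : ℕ) - 1, by omega⟩ else 0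

/-- The estimated FIR coefficients `g̃ = (g̃₁, …, g̃_{r−1})` from coarse-grained
identification with true coefficients `g` and additive noise on the outputs. -/
def coarseEst {r T mE : ℕ} (hrT : r ≤ T) (u : Fin mE → Fin T → ℝ)
    (g : Fin (r - 1) → ℝ) (noise : Fin mE → Fin T → ℝ) : Fin (r - 1) → ℝ :=
  fun i =>
    lsEst u (fun k => (toep (u k)).mulVec (pad hrT g) + noise k)
      ⟨(i : ℕ) + 1, by have := i.isLt; omega⟩

/-! ### Gaussian random vectors -/

/-- The standard Gaussian measure on `Fin r → ℝ` (i.i.d. `N(0,1)` coordinates). -/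
def stdGaussianPi (r : ℕ) : Measure (Fin r → ℝ) :=
  Measure.pi fun _ => gaussianReal 0 1

/-- `δ` is a centered Gaussian random vector with covariance `Cov`: its law is the
pushforward of the standard Gaussian under some `A` with `AAᵀ = Cov`. -/
def IsCenteredGaussianVec {Ω : Type} [MeasurableSpace Ω] (P : Measure Ω) {r : ℕ}
    (δ : Ω → Fin r → ℝ) (Cov : Matrix (Fin r) (Fin r) ℝ) : Prop :=
  ∃ A : Matrix (Fin r) (Fin r) ℝ, A * Aᵀ = Cov ∧
    Measure.map δ P = Measure.map (fun x => A.mulVec x) (stdGaussianPi r)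

/-- The law of i.i.d. `N(0, σ²)` noise across `mE` experiments of length `T`. -/
def iidGaussianLaw (mE T : ℕ) (σ2 : ℝ) : Measure (Fin mE → Fin T → ℝ) :=
  Measure.pi fun _ => Measure.pi fun _ => gaussianReal 0 σ2.toNNReal


/-- Scalar multiplication of a transfer matrix by a scalar transfer function. -/
def sMulTF {m n : ℕ} (c : TF) (M : TMat m n) : TMat m n := Matrix.of fun i j => c * M i j

/-- The perturbed response `Θ̂` with `R̂ = (I+Δ₁)⁻¹R̃`, `M̂ = M̃ − Δ₂(I+Δ₁)⁻¹R̃`,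
`N̂ = (I+Δ₁)⁻¹Ñ`, `L̂ = L̃ − Δ₂(I+Δ₁)⁻¹Ñ` (with the rational matrix inverse). -/
def deltaPerturb {n p q : ℕ} (Δ₁ : TMat n n) (Δ₂ : TMat p n) (Θ : Response n p q) :
    Response n p q where
  R := (1 + Δ₁)⁻¹ * Θ.R
  M := Θ.M - Δ₂ * ((1 + Δ₁)⁻¹ * Θ.R)
  N := (1 + Δ₁)⁻¹ * Θ.N
  L := Θ.L - Δ₂ * ((1 + Δ₁)⁻¹ * Θ.N)

/-- The Sherman–Morrison form of the perturbed response in the FIR SISO case: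
`[[R̂, N̂],[M̂, L̂]] = [[R̃, Ñ],[M̃, L̃]] + (1 − δᵀÑ)⁻¹·[Ñδᵀ; L̃δᵀ]·[R̃, Ñ]`. -/
def smPerturb {n : ℕ} (δ : Fin n → ℝ) (Θ : Response n 1 1) : Response n 1 1 where
  R := Θ.R + sMulTF (1 - (rmap (rowVec δ) * Θ.N) 0 0)⁻¹ (Θ.N * rmap (rowVec δ) * Θ.R)
  M := Θ.M + sMulTF (1 - (rmap (rowVec δ) * Θ.N) 0 0)⁻¹ (Θ.L * rmap (rowVec δ) * Θ.R)
  N := Θ.N + sMulTF (1 - (rmap (rowVec δ) * Θ.N) 0 0)⁻¹ (Θ.N * rmap (rowVec δ) * Θ.N)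
  L := Θ.L + sMulTF (1 - (rmap (rowVec δ) * Θ.N) 0 0)⁻¹ (Θ.L * rmap (rowVec δ) * Θ.N)

/-- The block-diagonal matrix with `m` copies of `Toep(g)` on the diagonal
(the action of `Toep(g)` on the stacked process noise of `m` experiments). -/
def bigToep {T mE : ℕ} (g : Fin T → ℝ) : Matrix (Fin mE × Fin T) (Fin mE × Fin T) ℝ :=
  Matrix.of fun pr qr => if pr.1 = qr.1 then toep g pr.2 qr.2 else 0

end SLS

namespace SLS

lemma evalTF_eq (f : TF) (z : ℂ) : evalTF f z = RatFunc.eval (algebraMap ℝ ℂ) z f := by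
  simp [evalTF, RatFunc.eval, Polynomial.eval_map]

lemma stable_iff (f : TF) :
    StableTF f ↔ ∀ z : ℂ, 1 ≤ ‖z‖ → (f.denom).eval₂ (algebraMap ℝ ℂ) z ≠ 0 := by
  unfold StableTF
  simp only [Polynomial.eval_map]
  constructor
  · intro h z hz h0
    exact absurd (h z h0) (not_lt.mpr hz)
  · intro h z h0
    by_contra hc
    exact h z (not_lt.mp hc) h0

lemma StableTF.add {f g : TF} (hf : StableTF f) (hg : StableTF g) : StableTF (f + g) := by
  rw [stable_iff] at *
  intro z hz h0
  have := Polynomial.eval₂_eq_zero_of_dvd_of_eval₂_eq_zero _ _ (RatFunc.denom_add_dvd f g) h0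
  rw [Polynomial.eval₂_mul] at this
  cases mul_eq_zero.mp this with
  | inl h => exact hf z hz h
  | inr h => exact hg z hz h

lemma StableTF.mul {f g : TF} (hf : StableTF f) (hg : StableTF g) : StableTF (f * g) := by
  rw [stable_iff] at *
  intro z hz h0
  have := Polynomial.eval₂_eq_zero_of_dvd_of_eval₂_eq_zero _ _ (RatFunc.denom_mul_dvd f g) h0
  rw [Polynomial.eval₂_mul] at this
  cases mul_eq_zero.mp this with
  | inl h => exact hf z hz h
  | inr h => exact hg z hz h

lemma StableTF.const (c : ℝ) : StableTF (RatFunc.C c) := by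
  rw [stable_iff]; intro z hz; simp

lemma StableTF.zero : StableTF 0 := by simpa using StableTF.const 0
lemma StableTF.one : StableTF 1 := by simpa using StableTF.const 1

lemma StableTF.sum {ι : Type*} (s : Finset ι) {f : ι → TF} (h : ∀ i ∈ s, StableTF (f i)) :
    StableTF (∑ i ∈ s, f i) :=
  Finset.sum_induction _ _ (fun _ _ => StableTF.add) StableTF.zero h

lemma evalTF_add {f g : TF} (hf : StableTF f) (hg : StableTF g) {z : ℂ} (hz : 1 ≤ ‖z‖) :
    evalTF (f + g) z = evalTF f z + evalTF g z := by
  rw [stable_iff] at *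
  simp only [evalTF_eq]
  exact RatFunc.eval_add _ _ (hf z hz) (hg z hz)

lemma evalTF_mul {f g : TF} (hf : StableTF f) (hg : StableTF g) {z : ℂ} (hz : 1 ≤ ‖z‖) :
    evalTF (f * g) z = evalTF f z * evalTF g z := by
  rw [stable_iff] at *
  simp only [evalTF_eq]
  exact RatFunc.eval_mul _ _ (hf z hz) (hg z hz)

@[simp] lemma evalTF_C (c : ℝ) (z : ℂ) : evalTF (RatFunc.C c) z = (c : ℂ) := by
  simp [evalTF_eq]
@[simp] lemma evalTF_zero (z : ℂ) : evalTF 0 z = 0 := by simp [evalTF_eq]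
@[simp] lemma evalTF_one (z : ℂ) : evalTF 1 z = 1 := by simp [evalTF_eq]

lemma evalTF_sum {ι : Type*} (s : Finset ι) {f : ι → TF} (h : ∀ i, StableTF (f i))
    {z : ℂ} (hz : 1 ≤ ‖z‖) :
    evalTF (∑ i ∈ s, f i) z = ∑ i ∈ s, evalTF (f i) z := by
  classical
  induction s using Finset.induction_on with
  | empty => simp
  | insert a s ha ih =>
    rw [Finset.sum_insert ha, Finset.sum_insert ha,
      evalTF_add (h a) (StableTF.sum s fun i _ => h i) hz, ih]

/-! Strict properness through the valuation at infinity. -/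

open Classical in
lemma proper_iff (f : TF) : ProperTF f ↔ RatFunc.inftyValuation ℝ f ≤ 1 := by
  by_cases h : f = 0
  · simp [h, ProperTF]
  · rw [RatFunc.inftyValuation_apply, RatFunc.inftyValuation_of_nonzero _ h, ProperTF,
      Polynomial.degree_eq_natDegree (RatFunc.num_ne_zero h),
      Polynomial.degree_eq_natDegree (RatFunc.denom_ne_zero f), ← WithZero.exp_zero,
      WithZero.exp_le_exp, RatFunc.intDegree]
    rw [Nat.cast_withBot, Nat.cast_withBot, WithBot.coe_le_coe]
    omega

open Classical in
lemma sproper_iff (f : TF) : StrictlyProperTF f ↔ RatFunc.inftyValuation ℝ f < 1 := by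
  by_cases h : f = 0
  · simp [h, StrictlyProperTF]
  · rw [RatFunc.inftyValuation_apply, RatFunc.inftyValuation_of_nonzero _ h, StrictlyProperTF,
      Polynomial.degree_eq_natDegree (RatFunc.num_ne_zero h),
      Polynomial.degree_eq_natDegree (RatFunc.denom_ne_zero f), ← WithZero.exp_zero,
      WithZero.exp_lt_exp, RatFunc.intDegree]
    rw [Nat.cast_withBot, Nat.cast_withBot, WithBot.coe_lt_coe]
    omega

lemma StrictlyProperTF.proper {f : TF} (h : StrictlyProperTF f) : ProperTF f := le_of_lt h

lemma StrictlyProperTF.add {f g : TF} (hf : StrictlyProperTF f) (hg : StrictlyProperTF g) :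
    StrictlyProperTF (f + g) := by
  classical
  rw [sproper_iff] at *
  exact Valuation.map_add_lt _ hf hg

lemma ProperTF.add {f g : TF} (hf : ProperTF f) (hg : ProperTF g) : ProperTF (f + g) := by
  classical
  rw [proper_iff] at *
  exact Valuation.map_add_le _ hf hg

lemma ProperTF.mul {f g : TF} (hf : ProperTF f) (hg : ProperTF g) : ProperTF (f * g) := by
  classical
  rw [proper_iff] at *
  rw [map_mul]
  exact mul_le_one' hf hg

lemma StrictlyProperTF.mul {f g : TF} (hf : ProperTF f) (hg : StrictlyProperTF g) :
    StrictlyProperTF (f * g) := by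
  classical
  rw [sproper_iff] at *
  rw [proper_iff] at *
  rw [map_mul]
  exact mul_lt_one_of_nonneg_of_lt_one_right hf (zero_le) hg

lemma ProperTF.const (c : ℝ) : ProperTF (RatFunc.C c) := by
  by_cases h : c = 0
  · simp [h, ProperTF]
  · unfold ProperTF
    simp [RatFunc.num_C, RatFunc.denom_C, Polynomial.degree_C h]

lemma StrictlyProperTF.zero : StrictlyProperTF 0 := by simp [StrictlyProperTF]

lemma StrictlyProperTF.sum {ι : Type*} (s : Finset ι) {f : ι → TF}
    (h : ∀ i ∈ s, StrictlyProperTF (f i)) : StrictlyProperTF (∑ i ∈ s, f i) :=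
  Finset.sum_induction _ _ (fun _ _ => StrictlyProperTF.add) StrictlyProperTF.zero h

lemma ProperTF.sum {ι : Type*} (s : Finset ι) {f : ι → TF}
    (h : ∀ i ∈ s, ProperTF (f i)) : ProperTF (∑ i ∈ s, f i) :=
  Finset.sum_induction _ _ (fun _ _ => ProperTF.add) StrictlyProperTF.zero.proper h

lemma StrictlyProperTF.neg {f : TF} (hf : StrictlyProperTF f) : StrictlyProperTF (-f) := by
  classical
  rw [sproper_iff] at *
  rwa [Valuation.map_neg]

open Classical in
lemma val_one_add {f : TF} (hf : StrictlyProperTF f) : RatFunc.inftyValuation ℝ (1 + f) = 1 := by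
  rw [sproper_iff] at hf
  exact Valuation.map_one_add_of_lt _ hf

lemma one_add_ne_zero {f : TF} (hf : StrictlyProperTF f) : 1 + f ≠ 0 := by
  classical
  intro h
  have := val_one_add hf
  rw [h] at this
  simp at this

lemma proper_inv_one_sub {f : TF} (hf : StrictlyProperTF f) : ProperTF (1 - f)⁻¹ := by
  classical
  rw [proper_iff, sub_eq_add_neg, map_inv₀, val_one_add hf.neg, inv_one]

lemma stable_inv {f : TF} (h : ∀ z : ℂ, 1 ≤ ‖z‖ → evalTF f z ≠ 0) : StableTF f⁻¹ := by
  have h0 : f ≠ 0 := by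
    rintro rfl
    exact h 1 (by simp) (by simp)
  rw [stable_iff]
  intro z hz hd
  have hdvd : RatFunc.denom f⁻¹ ∣ f.num := by
    rw [RatFunc.denom_dvd (RatFunc.num_ne_zero h0)]
    refine ⟨f.denom, ?_⟩
    nth_rw 1 [← RatFunc.num_div_denom f]
    rw [inv_div]
  have := Polynomial.eval₂_eq_zero_of_dvd_of_eval₂_eq_zero _ _ hdvd hd
  apply h z hz
  rw [evalTF_eq, RatFunc.eval, this, zero_div]

lemma eq_zero_of_circle {f : TF} (hs : StableTF f) (h : ∀ z : ℂ, ‖z‖ = 1 → evalTF f z = 0) :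
    f = 0 := by
  rw [stable_iff] at hs
  have : f.num.map (algebraMap ℝ ℂ) = 0 := by
    apply Polynomial.eq_zero_of_infinite_isRoot
    refine Set.Infinite.mono (s := Metric.sphere (0 : ℂ) 1) ?_ ?_
    · intro z hz
      have hz1 : ‖z‖ = 1 := by simpa using hz
      have h1 := h z hz1
      rw [evalTF_eq, RatFunc.eval, div_eq_zero_iff] at h1
      have h2 := h1.resolve_right (hs z hz1.ge)
      simpa [Polynomial.IsRoot, Polynomial.eval_map] using h2
    · have : (Metric.sphere (0 : ℂ) 1).Nontrivial := ⟨1, by simp, -1, by simp, by norm_num⟩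
      apply IsPreconnected.infinite_of_nontrivial _ this
      exact isPreconnected_sphere (by simp) 0 1
  rw [Polynomial.map_eq_zero] at this
  exact RatFunc.num_eq_zero_iff.mp this

lemma evalTF_diff {f : TF} (hs : StableTF f) {z : ℂ} (hz : 1 ≤ ‖z‖) :
    DifferentiableAt ℂ (evalTF f) z := by
  have h : (f.denom.map (algebraMap ℝ ℂ)).eval z ≠ 0 := by
    rw [stable_iff] at hs
    simpa [Polynomial.eval_map] using hs z hz
  unfold evalTF
  exact (Polynomial.differentiableAt _).div (Polynomial.differentiableAt _) h

lemma evalTF_bdd {f : TF} (hs : StableTF f) : ∃ C, ∀ z : ℂ, ‖z‖ = 1 → ‖evalTF f z‖ ≤ C := by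
  have hc : ContinuousOn (evalTF f) (Metric.sphere (0 : ℂ) 1) := fun z hz =>
    (evalTF_diff hs (by simpa using (mem_sphere_zero_iff_norm.mp hz).ge)).continuousAt.continuousWithinAt
  obtain ⟨C, hC⟩ := (isCompact_sphere (0 : ℂ) 1).exists_bound_of_continuousOn hc
  exact ⟨C, fun z hz => hC z (by simpa using hz)⟩

/-- Maximum modulus principle on the exterior of the unit disk. -/
lemma evalTF_max {f : TF} (hs : StableTF f) (hp : StrictlyProperTF f) {b : ℝ} (hb : 0 < b)
    (h : ∀ z : ℂ, ‖z‖ = 1 → ‖evalTF f z‖ ≤ b) {z : ℂ} (hz : 1 ≤ ‖z‖) : ‖evalTF f z‖ ≤ b := by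
  have hlo : ∀ᶠ w in Bornology.cobounded ℂ, ‖evalTF f w‖ ≤ b := by
    have hdeg : (f.num.map (algebraMap ℝ ℂ)).degree < (f.denom.map (algebraMap ℝ ℂ)).degree := by
      rw [Polynomial.degree_map, Polynomial.degree_map]; exact hp
    have := (Polynomial.isLittleO_cobounded_of_degree_lt hdeg).def hb
    filter_upwards [this] with w hw
    rw [evalTF, norm_div]
    exact div_le_of_le_mul₀ (norm_nonneg _) hb.le hw
  rw [← comap_norm_atTop, Filter.eventually_comap] at hlo
  obtain ⟨ρ, hρ1, hρ2⟩ := (hlo.and (Filter.eventually_gt_atTop ‖z‖)).exists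
  let U : Set ℂ := {w | 1 < ‖w‖} ∩ {w | ‖w‖ < ρ}
  have hcl : closure U ⊆ {w | 1 ≤ ‖w‖} ∩ {w | ‖w‖ ≤ ρ} := by
    apply closure_minimal
    · rintro w ⟨h1, h2⟩; exact ⟨show 1 ≤ ‖w‖ from LT.lt.le h1, show ‖w‖ ≤ ρ from LT.lt.le h2⟩
    · exact (isClosed_le continuous_const continuous_norm).inter
        (isClosed_le continuous_norm continuous_const)
  have hopen : IsOpen U := (isOpen_lt continuous_const continuous_norm).inter
        (isOpen_lt continuous_norm continuous_const)
  have hbdd : Bornology.IsBounded U := by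
    apply (Metric.isBounded_ball (x := (0 : ℂ)) (r := ρ)).subset
    rintro w ⟨_, h2⟩; simpa using h2
  rcases hz.eq_or_lt with h1 | h1
  · exact h z h1.symm
  · refine Complex.norm_le_of_forall_mem_frontier_norm_le hbdd ?_ ?_ (subset_closure ⟨h1, hρ2⟩)
    · apply DifferentiableOn.diffContOnCl
      intro w hw
      exact (evalTF_diff hs (hcl hw).1).differentiableWithinAt
    · intro w hw
      rw [hopen.frontier_eq] at hw
      have h3 := hcl hw.1
      by_cases h4 : ‖w‖ = 1
      · exact h w h4
      · apply hρ1 w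
        by_contra h5
        exact hw.2 ⟨lt_of_le_of_ne h3.1 (Ne.symm h4), lt_of_le_of_ne h3.2 h5⟩

end SLS

namespace SLS

/-- Entrywise stability of a transfer matrix. -/
def MS {m n : ℕ} (F : TMat m n) : Prop := ∀ i j, StableTF (F i j)

variable {l m n : ℕ}

lemma MemRHinf.ms {F : TMat m n} (h : MemRHinf F) : MS F := fun i j => (h i j).2

lemma MS.add {F G : TMat m n} (hF : MS F) (hG : MS G) : MS (F + G) :=
  fun i j => (hF i j).add (hG i j)

lemma MS.mul {F : TMat l m} {G : TMat m n} (hF : MS F) (hG : MS G) : MS (F * G) := by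
  intro i j
  rw [Matrix.mul_apply]
  exact StableTF.sum _ fun k _ => (hF i k).mul (hG k j)

lemma MS.smul {c : TF} {F : TMat m n} (hc : StableTF c) (hF : MS F) : MS (c • F) :=
  fun i j => hc.mul (hF i j)

lemma MS.rmap (A : Matrix (Fin m) (Fin n) ℝ) : MS (rmap A) := fun _ _ => StableTF.const _

lemma evalMat_add {F G : TMat m n} (hF : MS F) (hG : MS G) {z : ℂ} (hz : 1 ≤ ‖z‖) :
    evalMat (F + G) z = evalMat F z + evalMat G z := by
  ext i j
  exact evalTF_add (hF i j) (hG i j) hz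

lemma evalMat_mul {F : TMat l m} {G : TMat m n} (hF : MS F) (hG : MS G) {z : ℂ} (hz : 1 ≤ ‖z‖) :
    evalMat (F * G) z = evalMat F z * evalMat G z := by
  ext i j
  simp only [evalMat, Matrix.of_apply, Matrix.mul_apply]
  rw [evalTF_sum _ (fun k => (hF i k).mul (hG k j)) hz]
  exact Finset.sum_congr rfl fun k _ => evalTF_mul (hF i k) (hG k j) hz

lemma evalMat_smul {c : TF} {F : TMat m n} (hc : StableTF c) (hF : MS F) {z : ℂ} (hz : 1 ≤ ‖z‖) :
    evalMat (c • F) z = evalTF c z • evalMat F z := by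
  ext i j
  exact evalTF_mul hc (hF i j) hz

/-! Spectral norm. -/

lemma specNorm_nonneg (A : Matrix (Fin m) (Fin n) ℂ) : 0 ≤ specNorm A := norm_nonneg _

lemma specNorm_add (A B : Matrix (Fin m) (Fin n) ℂ) :
    specNorm (A + B) ≤ specNorm A + specNorm B := by
  unfold specNorm
  rw [map_add, map_add]
  exact norm_add_le _ _

lemma specNorm_smul (c : ℂ) (A : Matrix (Fin m) (Fin n) ℂ) :
    specNorm (c • A) = ‖c‖ * specNorm A := by
  unfold specNorm
  rw [map_smul, map_smul]
  exact norm_smul _ _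

open scoped Matrix.Norms.L2Operator in
lemma specNorm_eq (A : Matrix (Fin m) (Fin n) ℂ) : specNorm A = ‖A‖ := by
  rw [Matrix.l2_opNorm_def]; rfl

lemma specNorm_mul (A : Matrix (Fin l) (Fin m) ℂ) (B : Matrix (Fin m) (Fin n) ℂ) :
    specNorm (A * B) ≤ specNorm A * specNorm B := by
  rw [specNorm_eq, specNorm_eq, specNorm_eq]
  exact Matrix.l2_opNorm_mul A B

lemma specNorm_entry (A : Matrix (Fin m) (Fin n) ℂ) (i : Fin m) (j : Fin n) :
    ‖A i j‖ ≤ specNorm A := by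
  have h1 := ContinuousLinearMap.le_opNorm (LinearMap.toContinuousLinearMap (Matrix.toEuclideanLin A))
    (EuclideanSpace.single j (1 : ℂ))
  have h2 := PiLp.norm_apply_le (LinearMap.toContinuousLinearMap (Matrix.toEuclideanLin A)
    (EuclideanSpace.single j (1 : ℂ))) i
  rw [PiLp.norm_single, norm_one, mul_one] at h1
  refine le_trans (le_of_eq ?_) (h2.trans h1)
  simp [Matrix.toLpLin_apply]

/-- Frobenius bound. -/
lemma specNorm_le_frob (A : Matrix (Fin m) (Fin n) ℂ) :
    specNorm A ≤ Real.sqrt (∑ i, ∑ j, ‖A i j‖ ^ 2) := by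
  unfold specNorm
  refine ContinuousLinearMap.opNorm_le_bound _ (Real.sqrt_nonneg _) fun x => ?_
  rw [EuclideanSpace.norm_eq, EuclideanSpace.norm_eq, ← Real.sqrt_mul (by positivity)]
  apply Real.sqrt_le_sqrt
  rw [Finset.sum_mul]
  apply Finset.sum_le_sum
  intro i _
  have : (LinearMap.toContinuousLinearMap (Matrix.toEuclideanLin A) x) i = ∑ j, A i j * x j := by
    simp [Matrix.toLpLin_apply, Matrix.mulVec, dotProduct]
  rw [this]
  calc ‖∑ j, A i j * x j‖ ^ 2 ≤ (∑ j, ‖A i j‖ * ‖x j‖) ^ 2 := by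
        gcongr
        refine (norm_sum_le _ _).trans (le_of_eq ?_)
        simp
    _ ≤ _ := Finset.sum_mul_sq_le_sq_mul_sq _ _ _

lemma hinf_le {F : TMat m n} {b : ℝ}
    (h : ∀ z : ℂ, ‖z‖ = 1 → specNorm (evalMat F z) ≤ b) : hinfNorm F ≤ b := by
  apply csSup_le
  · exact ⟨_, 1, by simp, rfl⟩
  · rintro x ⟨z, hz, rfl⟩
    exact h z hz

lemma le_hinf {F : TMat m n} (hF : MS F) {z : ℂ} (hz : ‖z‖ = 1) :
    specNorm (evalMat F z) ≤ hinfNorm F := by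
  refine le_csSup ?_ ⟨z, hz, rfl⟩
  choose C hC using fun i j => evalTF_bdd (hF i j)
  refine ⟨Real.sqrt (∑ i, ∑ j, C i j ^ 2), ?_⟩
  rintro x ⟨w, hw, rfl⟩
  refine (specNorm_le_frob _).trans (Real.sqrt_le_sqrt ?_)
  gcongr with i _ j _
  exact hC i j w hw

lemma hinf_nonneg {F : TMat m n} : 0 ≤ hinfNorm F := by
  apply Real.sSup_nonneg
  rintro x ⟨z, hz, rfl⟩
  exact specNorm_nonneg _

lemma specNorm_row (d : Fin n → ℝ) (z : ℂ) : specNorm (evalMat (rmap (rowVec d)) z) ≤ euclNorm d := by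
  refine (specNorm_le_frob _).trans (le_of_eq ?_)
  simp [euclNorm, evalMat, rmap, rowVec]

end SLS

namespace SLS

set_option linter.unusedSimpArgs false

section algebra

variable {n k : ℕ}

lemma one_by_one (S : TMat 1 1) : S = (S 0 0) • (1 : TMat 1 1) := by
  ext i j
  fin_cases i; fin_cases j; simp

lemma sMulTF_eq {m n : ℕ} (c : TF) (M : TMat m n) : sMulTF c M = c • M := rfl

/-- The scalar `δᵀN`. -/
def tsc (d : Fin n → ℝ) (Θ : Response n 1 1) : TF := (rmap (rowVec d) * Θ.N) 0 0

lemma DN_eq (d : Fin n → ℝ) (Θ : Response n 1 1) :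
    rmap (rowVec d) * Θ.N = tsc d Θ • (1 : TMat 1 1) := one_by_one _

lemma DN_mul (d : Fin n → ℝ) (Θ : Response n 1 1) (F : TMat 1 k) :
    rmap (rowVec d) * (Θ.N * F) = tsc d Θ • F := by
  rw [← Matrix.mul_assoc, DN_eq]; simp

lemma rowVec_add (g d : Fin n → ℝ) :
    rmap (rowVec (fun i => g i + d i)) = rmap (rowVec g) + rmap (rowVec d) := by
  ext i j; simp [rmap, rowVec]

lemma sm_c {d : Fin n → ℝ} {Θ : Response n 1 1} (hc : 1 - tsc d Θ ≠ 0) :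
    (1 - tsc d Θ)⁻¹ * tsc d Θ = (1 - tsc d Θ)⁻¹ - 1 := by
  field_simp
  ring

lemma sm_R (d : Fin n → ℝ) (Θ : Response n 1 1) : (smPerturb d Θ).R =
    Θ.R + (1 - tsc d Θ)⁻¹ • (Θ.N * (rmap (rowVec d) * Θ.R)) := by
  simp only [smPerturb, sMulTF_eq, Matrix.mul_assoc]; rfl

lemma sm_M (d : Fin n → ℝ) (Θ : Response n 1 1) : (smPerturb d Θ).M =
    Θ.M + (1 - tsc d Θ)⁻¹ • (Θ.L * (rmap (rowVec d) * Θ.R)) := by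
  simp only [smPerturb, sMulTF_eq, Matrix.mul_assoc]; rfl

lemma sm_N' (d : Fin n → ℝ) (Θ : Response n 1 1) : (smPerturb d Θ).N =
    Θ.N + (1 - tsc d Θ)⁻¹ • (Θ.N * (rmap (rowVec d) * Θ.N)) := by
  simp only [smPerturb, sMulTF_eq, Matrix.mul_assoc]; rfl

lemma sm_L' (d : Fin n → ℝ) (Θ : Response n 1 1) : (smPerturb d Θ).L =
    Θ.L + (1 - tsc d Θ)⁻¹ • (Θ.L * (rmap (rowVec d) * Θ.N)) := by
  simp only [smPerturb, sMulTF_eq, Matrix.mul_assoc]; rfl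

lemma sm_N {d : Fin n → ℝ} {Θ : Response n 1 1} (hc : 1 - tsc d Θ ≠ 0) :
    (smPerturb d Θ).N = (1 - tsc d Θ)⁻¹ • Θ.N := by
  rw [sm_N', DN_eq d, Matrix.mul_smul, Matrix.mul_one, smul_smul, sm_c hc]
  (simp only [smul_add, smul_sub, sub_smul, add_smul, one_smul]; abel)

lemma sm_L {d : Fin n → ℝ} {Θ : Response n 1 1} (hc : 1 - tsc d Θ ≠ 0) :
    (smPerturb d Θ).L = (1 - tsc d Θ)⁻¹ • Θ.L := by
  rw [sm_L', DN_eq d, Matrix.mul_smul, Matrix.mul_one, smul_smul, sm_c hc]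
  (simp only [smul_add, smul_sub, sub_smul, add_smul, one_smul]; abel)

/-- Equality constraints for the perturbed response. -/
lemma sm_eqs {g d : Fin n → ℝ} {Θ : Response n 1 1} (hc : 1 - tsc d Θ ≠ 0)
    (A : TMat n n) (E : TMat n 1)
    (h1 : A * Θ.R - E * Θ.M = 1) (h2 : A * Θ.N - E * Θ.L = 0)
    (h3 : Θ.R * A - Θ.N * rmap (rowVec g) = 1)
    (h4 : Θ.M * A - Θ.L * rmap (rowVec g) = 0) :
    A * (smPerturb d Θ).R - E * (smPerturb d Θ).M = 1 ∧
    A * (smPerturb d Θ).N - E * (smPerturb d Θ).L = 0 ∧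
    (smPerturb d Θ).R * A - (smPerturb d Θ).N * rmap (rowVec (fun i => g i + d i)) = 1 ∧
    (smPerturb d Θ).M * A - (smPerturb d Θ).L * rmap (rowVec (fun i => g i + d i)) = 0 := by
  have hct := sm_c hc
  have h3' : Θ.R * A = 1 + Θ.N * rmap (rowVec g) := by rw [← h3]; abel
  have h4' : Θ.M * A = Θ.L * rmap (rowVec g) := sub_eq_zero.mp h4
  have h1' : A * Θ.R = 1 + E * Θ.M := by rw [← h1]; abel
  have h2' : A * Θ.N = E * Θ.L := sub_eq_zero.mp h2
  refine ⟨?_, ?_, ?_, ?_⟩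
  · rw [sm_R, sm_M, Matrix.mul_add, Matrix.mul_add, Matrix.mul_smul, Matrix.mul_smul,
      ← Matrix.mul_assoc A, ← Matrix.mul_assoc E Θ.L, h2', h1']
    abel
  · rw [sm_N hc, sm_L hc, Matrix.mul_smul, Matrix.mul_smul, h2', sub_self]
  · rw [sm_R, sm_N hc, rowVec_add, Matrix.add_mul, Matrix.smul_mul, Matrix.mul_assoc Θ.N,
      Matrix.mul_assoc _ Θ.R, h3', Matrix.mul_add, Matrix.mul_one, DN_mul d, Matrix.mul_add,
      Matrix.mul_smul, Matrix.smul_mul, Matrix.mul_add, smul_add, smul_smul, hct]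
    (simp only [smul_add, smul_sub, sub_smul, add_smul, one_smul]; abel)
  · rw [sm_M, sm_L hc, rowVec_add, Matrix.add_mul, Matrix.smul_mul, Matrix.mul_assoc Θ.L,
      Matrix.mul_assoc _ Θ.R, h3', h4', Matrix.mul_add, Matrix.mul_one, DN_mul d, Matrix.mul_add,
      Matrix.mul_smul, Matrix.smul_mul, Matrix.mul_add, smul_add, smul_smul, hct]
    (simp only [smul_add, smul_sub, sub_smul, add_smul, one_smul]; abel)

/-- The controller achieves the perturbed response. -/
lemma sm_ctrl {g d : Fin n → ℝ} {Θ : Response n 1 1} (hc : 1 - tsc d Θ ≠ 0)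
    (A : TMat n n) (hR : IsUnit Θ.R.det)
    (h3 : Θ.R * A - Θ.N * rmap (rowVec g) = 1)
    (h4 : Θ.M * A - Θ.L * rmap (rowVec g) = 0) :
    (smPerturb d Θ).M = controller Θ * rmap (rowVec (fun i => g i + d i)) * (smPerturb d Θ).R ∧
    (smPerturb d Θ).L = controller Θ * rmap (rowVec (fun i => g i + d i)) * (smPerturb d Θ).N
      + controller Θ := by
  have hct := sm_c hc
  have h3' : Θ.N * rmap (rowVec g) = Θ.R * A - 1 := by rw [← h3]; abel
  have h4' : Θ.L * rmap (rowVec g) = Θ.M * A := (sub_eq_zero.mp h4).symm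
  have hinv : Θ.R⁻¹ * Θ.R = 1 := Matrix.nonsing_inv_mul _ hR
  have hMN : Θ.M * Θ.R⁻¹ * Θ.N = Θ.L - controller Θ := by
    rw [controller]; abel
  have hKG : controller Θ * rmap (rowVec g) = Θ.M * Θ.R⁻¹ := by
    rw [controller, Matrix.sub_mul, h4', Matrix.mul_assoc, h3', Matrix.mul_sub, Matrix.mul_one,
      ← Matrix.mul_assoc, Matrix.mul_assoc Θ.M, hinv, Matrix.mul_one]
    abel
  generalize controller Θ = K at *
  constructor
  · rw [sm_M, sm_R, rowVec_add, Matrix.mul_add K, hKG, Matrix.add_mul, Matrix.mul_add,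
      Matrix.mul_assoc Θ.M _ Θ.R, hinv, Matrix.mul_one, Matrix.mul_smul,
      ← Matrix.mul_assoc _ Θ.N, hMN, Matrix.mul_assoc K, Matrix.mul_add, Matrix.mul_smul, DN_mul d,
      Matrix.mul_add, Matrix.mul_smul, Matrix.mul_smul, smul_smul, hct, Matrix.sub_mul]
    (simp only [smul_add, smul_sub, sub_smul, add_smul, one_smul]; abel)
  · rw [sm_L hc, sm_N hc, rowVec_add, Matrix.mul_add, hKG, Matrix.add_mul, Matrix.mul_smul, hMN,
      Matrix.mul_smul, Matrix.mul_assoc K, DN_eq d, Matrix.mul_smul, Matrix.mul_one, smul_smul, hct]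
    (simp only [smul_add, smul_sub, sub_smul, add_smul, one_smul]; abel)

/-- The column `[1; 0]`. -/
def E0 : TMat 2 1 := Matrix.of fun i _ => if (i : ℕ) = 0 then 1 else 0

lemma C1_eq (g : Fin n → ℝ) : rmap (C1mat g) = E0 * rmap (rowVec g) := by
  ext i j
  fin_cases i <;> simp [rmap, C1mat, E0, rowVec, Matrix.mul_apply]

lemma col2_eq (g : Fin n → ℝ) (Θ : Response n 1 1) :
    col2 (1 + (rmap (rowVec g) * Θ.N) 0 0) (Θ.L 0 0) =
      E0 * (1 + rmap (rowVec g) * Θ.N) + rmap D12mat * Θ.L := by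
  ext i j
  fin_cases j
  fin_cases i <;> simp [col2, rmap, D12mat, E0, Matrix.mul_apply]

/-- The performance column. -/
def Vcol (g : Fin n → ℝ) (Θ : Response n 1 1) : TMat 2 1 :=
  E0 * (1 + rmap (rowVec g) * Θ.N) + rmap D12mat * Θ.L

lemma perf_eq (g : Fin n → ℝ) (Θ : Response n 1 1) : perfWeight g Θ = hinfNorm (Vcol g Θ) := by
  rw [perfWeight, col2_eq]; rfl

lemma sm_Vcol {g d : Fin n → ℝ} {Θ : Response n 1 1} (hc : 1 - tsc d Θ ≠ 0) :
    Vcol (fun i => g i + d i) (smPerturb d Θ) = (1 - tsc d Θ)⁻¹ • Vcol g Θ := by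
  have hct := sm_c hc
  have h : 1 + rmap (rowVec (fun i => g i + d i)) * (smPerturb d Θ).N =
      (1 - tsc d Θ)⁻¹ • (1 + rmap (rowVec g) * Θ.N) := by
    rw [sm_N hc, rowVec_add, Matrix.mul_smul, Matrix.add_mul, DN_eq d, smul_add, smul_smul, hct]
    simp only [smul_add, sub_smul, one_smul]
    abel
  unfold Vcol
  rw [h, sm_L hc, Matrix.mul_smul, Matrix.mul_smul, smul_add]

/-- Cost matrix. -/
def Cmat {nw : ℕ} (g : Fin n → ℝ) (B₁ : Matrix (Fin n) (Fin nw) ℝ)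
    (D₂₁ : Matrix (Fin 1) (Fin nw) ℝ) (D₁₁ : Matrix (Fin 2) (Fin nw) ℝ)
    (Θ : Response n 1 1) : TMat 2 nw :=
  (rmap (C1mat g) * Θ.R + rmap D12mat * Θ.M) * rmap B₁ +
    (rmap (C1mat g) * Θ.N + rmap D12mat * Θ.L) * rmap D₂₁ + rmap D₁₁

/-- `RB₁ + ND₂₁`. -/
def Wmat {nw : ℕ} (B₁ : Matrix (Fin n) (Fin nw) ℝ)
    (D₂₁ : Matrix (Fin 1) (Fin nw) ℝ) (Θ : Response n 1 1) : TMat n nw :=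
  Θ.R * rmap B₁ + Θ.N * rmap D₂₁

lemma sm_Wmat {nw : ℕ} (B₁ : Matrix (Fin n) (Fin nw) ℝ)
    (D₂₁ : Matrix (Fin 1) (Fin nw) ℝ) (d : Fin n → ℝ) (Θ : Response n 1 1) :
    Wmat B₁ D₂₁ (smPerturb d Θ) =
      Wmat B₁ D₂₁ Θ + (1 - tsc d Θ)⁻¹ • (Θ.N * (rmap (rowVec d) * Wmat B₁ D₂₁ Θ)) := by
  unfold Wmat
  rw [sm_R, sm_N']
  simp only [Matrix.add_mul, Matrix.mul_add, Matrix.smul_mul, Matrix.mul_assoc]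
  (simp only [smul_add, smul_sub, sub_smul, add_smul, one_smul]; abel)

lemma sm_Cmat {nw : ℕ} (B₁ : Matrix (Fin n) (Fin nw) ℝ)
    (D₂₁ : Matrix (Fin 1) (Fin nw) ℝ) (D₁₁ : Matrix (Fin 2) (Fin nw) ℝ)
    {g d : Fin n → ℝ} {Θ : Response n 1 1} (hc : 1 - tsc d Θ ≠ 0) :
    Cmat (fun i => g i + d i) B₁ D₂₁ D₁₁ (smPerturb d Θ) =
      Cmat g B₁ D₂₁ D₁₁ Θ +
        (1 - tsc d Θ)⁻¹ • (Vcol g Θ * (rmap (rowVec d) * Wmat B₁ D₂₁ Θ)) := by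
  have hct := sm_c hc
  have hGR : rmap (rowVec (fun i => g i + d i)) * (smPerturb d Θ).R = rmap (rowVec g) * Θ.R +
      (1 - tsc d Θ)⁻¹ • ((1 + rmap (rowVec g) * Θ.N) * (rmap (rowVec d) * Θ.R)) := by
    rw [sm_R, rowVec_add, Matrix.add_mul, Matrix.mul_add, Matrix.mul_add, Matrix.mul_smul,
      Matrix.mul_smul, DN_mul d, smul_smul, hct, Matrix.add_mul, Matrix.one_mul,
      Matrix.mul_assoc _ Θ.N]
    (simp only [smul_add, smul_sub, sub_smul, add_smul, one_smul]; abel)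
  have hGN : rmap (rowVec (fun i => g i + d i)) * (smPerturb d Θ).N = rmap (rowVec g) * Θ.N +
      (1 - tsc d Θ)⁻¹ • ((1 + rmap (rowVec g) * Θ.N) * (rmap (rowVec d) * Θ.N)) := by
    rw [sm_N', rowVec_add, Matrix.add_mul, Matrix.mul_add, Matrix.mul_add, Matrix.mul_smul,
      Matrix.mul_smul, DN_mul d, smul_smul, hct, Matrix.add_mul, Matrix.one_mul,
      Matrix.mul_assoc _ Θ.N]
    (simp only [smul_add, smul_sub, sub_smul, add_smul, one_smul]; abel)
  unfold Cmat Vcol Wmat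
  rw [C1_eq, C1_eq, Matrix.mul_assoc E0, Matrix.mul_assoc E0, hGR, hGN, sm_M, sm_L']
  simp only [Matrix.add_mul, Matrix.mul_add, Matrix.smul_mul, Matrix.mul_smul, Matrix.mul_assoc,
    Matrix.one_mul, smul_add]
  abel

end algebra

end SLS

namespace SLS

section bounds

variable {n nw : ℕ}

lemma real_aux1 {x : ℝ} (P : ℝ) (h1 : 1 - x ≠ 0) (h2 : 1 - 2 * x ≠ 0) :
    x * (P / (1 - 2 * x)) * (1 - x)⁻¹ + (1 - x)⁻¹ * P = P / (1 - 2 * x) := by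
  have h : x = (1 - x) - (1 - 2 * x) := by ring
  generalize 1 - x = a at *
  generalize 1 - 2 * x = b at *
  subst h
  field_simp
  ring

lemma real_aux2 {x : ℝ} (P e W : ℝ) (h1 : 1 - x ≠ 0) (h2 : 1 - 2 * x ≠ 0) :
    (1 - x)⁻¹ * (P * (e * W)) + e * (P / (1 - 2 * x)) * (W + (1 - x)⁻¹ * (x * W)) =
      e * P * W * (2 / (1 - 2 * x)) := by
  have h : x = (1 - x) - (1 - 2 * x) := by ring
  generalize 1 - x = a at *
  generalize 1 - 2 * x = b at *
  subst h
  field_simp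
  ring

lemma real_aux3 {e N W P α : ℝ} (h1 : 0 < 1 - e * N) (he : 0 ≤ e) (hW : 0 ≤ W)
    (h : e * α * N + P ≤ α) : (1 - e * N)⁻¹ * (P * (e * W)) ≤ e * α * W := by
  have : (1 - e * N)⁻¹ * P ≤ α := by
    rw [inv_mul_le_iff₀ h1]
    linarith
  calc _ = ((1 - e * N)⁻¹ * P) * (e * W) := by ring
    _ ≤ α * (e * W) := by gcongr
    _ = _ := by ring

lemma real_aux4 {a b c d f x y : ℝ} (h1 : a ≤ b + c) (h2 : c ≤ d) (h3 : b + d ≤ f)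
    (h4 : f ≤ x + y) : a - x ≤ y := by linarith

lemma rowN_sp {m n k : ℕ} (A : Matrix (Fin m) (Fin n) ℝ) {F : TMat n k} (hF : StrictlyProper F) :
    StrictlyProper (rmap A * F) := by
  intro i j
  rw [Matrix.mul_apply]
  exact StrictlyProperTF.sum _ fun l _ => StrictlyProperTF.mul (ProperTF.const _) (hF l j)

lemma sp_mul {m n k : ℕ} {A : TMat m n} (hA : ∀ i j, ProperTF (A i j)) {F : TMat n k}
    (hF : StrictlyProper F) : StrictlyProper (A * F) := by
  intro i j
  rw [Matrix.mul_apply]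
  exact StrictlyProperTF.sum _ fun l _ => StrictlyProperTF.mul (hA i l) (hF l j)

lemma sp_add {m n : ℕ} {A B : TMat m n} (hA : StrictlyProper A) (hB : StrictlyProper B) :
    StrictlyProper (A + B) := fun i j => (hA i j).add (hB i j)

lemma sp_smul {m n : ℕ} {c : TF} (hc : ProperTF c) {B : TMat m n} (hB : StrictlyProper B) :
    StrictlyProper (c • B) := fun i j => StrictlyProperTF.mul hc (hB i j)

lemma Vcol_ms (g : Fin n → ℝ) {Θ : Response n 1 1} (hΘ : SLSStable Θ) : MS (Vcol g Θ) := by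
  obtain ⟨-, -, -, -, -, hN, hL⟩ := hΘ
  refine MS.add (MS.mul ?_ (MS.add ?_ ((MS.rmap _).mul hN.ms))) ((MS.rmap _).mul hL.ms)
  · intro i j
    simp only [E0, Matrix.of_apply]
    split_ifs
    · exact StableTF.one
    · exact StableTF.zero
  · intro i j
    fin_cases i; fin_cases j
    exact StableTF.one

lemma Wmat_ms (B₁ : Matrix (Fin n) (Fin nw) ℝ)
    (D₂₁ : Matrix (Fin 1) (Fin nw) ℝ) {Θ : Response n 1 1} (hΘ : SLSStable Θ) :
    MS (Wmat B₁ D₂₁ Θ) := by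
  obtain ⟨-, -, -, hR, -, hN, -⟩ := hΘ
  exact (hR.ms.mul (MS.rmap _)).add (hN.ms.mul (MS.rmap _))

lemma Cmat_ms (g : Fin n → ℝ) (B₁ : Matrix (Fin n) (Fin nw) ℝ)
    (D₂₁ : Matrix (Fin 1) (Fin nw) ℝ) (D₁₁ : Matrix (Fin 2) (Fin nw) ℝ)
    {Θ : Response n 1 1} (hΘ : SLSStable Θ) :
    MS (Cmat g B₁ D₂₁ D₁₁ Θ) := by
  obtain ⟨-, -, -, hR, hM, hN, hL⟩ := hΘ
  exact (((((MS.rmap _).mul hR.ms).add ((MS.rmap _).mul hM.ms)).mul (MS.rmap _)).add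
    ((((MS.rmap _).mul hN.ms).add ((MS.rmap _).mul hL.ms)).mul (MS.rmap _))).add (MS.rmap _)

lemma perf_pos (g : Fin n → ℝ) {Θ : Response n 1 1} (hΘ : SLSStable Θ) : 0 < perfWeight g Θ := by
  rw [perf_eq]
  refine lt_of_le_of_ne hinf_nonneg fun h0 => ?_
  have hV := Vcol_ms g hΘ
  have hz : Vcol g Θ 0 0 = 0 := by
    apply eq_zero_of_circle (hV 0 0)
    intro z hz
    have h1 := specNorm_entry (evalMat (Vcol g Θ) z) 0 0
    have h2 := le_hinf hV hz
    rw [← h0] at h2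
    exact norm_le_zero_iff.mp (h1.trans h2)
  rw [Vcol, ← col2_eq] at hz
  simp only [col2, Matrix.of_apply] at hz
  exact one_add_ne_zero (rowN_sp (rowVec g) hΘ.2.2.1 0 0) (by simpa using hz)

lemma tsc_stable (d : Fin n → ℝ) {Θ : Response n 1 1} (hΘ : SLSStable Θ) :
    StableTF (tsc d Θ) := (MS.rmap _).mul hΘ.2.2.2.2.2.1.ms 0 0

lemma tsc_sp (d : Fin n → ℝ) {Θ : Response n 1 1} (hΘ : SLSStable Θ) :
    StrictlyProperTF (tsc d Θ) := rowN_sp _ hΘ.2.2.1 0 0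

lemma one_sub_tsc_ne (d : Fin n → ℝ) {Θ : Response n 1 1} (hΘ : SLSStable Θ) :
    1 - tsc d Θ ≠ 0 := by
  rw [sub_eq_add_neg]
  exact one_add_ne_zero (tsc_sp d hΘ).neg

lemma tsc_bound {d : Fin n → ℝ} {ε : ℝ} (hd : euclNorm d ≤ ε) {Θ : Response n 1 1}
    (hΘ : SLSStable Θ) {z : ℂ} (hz : ‖z‖ = 1) : ‖evalTF (tsc d Θ) z‖ ≤ ε * hinfNorm Θ.N := by
  have hN := hΘ.2.2.2.2.2.1.ms
  calc ‖evalTF (tsc d Θ) z‖ ≤ specNorm (evalMat (rmap (rowVec d) * Θ.N) z) :=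
        specNorm_entry (evalMat (rmap (rowVec d) * Θ.N) z) 0 0
    _ ≤ specNorm (evalMat (rmap (rowVec d)) z) * specNorm (evalMat Θ.N z) := by
        rw [evalMat_mul (MS.rmap _) hN hz.ge]
        exact specNorm_mul _ _
    _ ≤ ε * hinfNorm Θ.N := by
        apply mul_le_mul ((specNorm_row d z).trans hd) (le_hinf hN hz) (specNorm_nonneg _)
        exact (Real.sqrt_nonneg _).trans hd

lemma evalTF_one_sub {d : Fin n → ℝ} {Θ : Response n 1 1}
    (hΘ : SLSStable Θ) {z : ℂ} (hz : 1 ≤ ‖z‖) :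
    evalTF (1 - tsc d Θ) z = 1 - evalTF (tsc d Θ) z := by
  have hs := tsc_stable d hΘ
  have : (1 : TF) - tsc d Θ = 1 + RatFunc.C (-1) * tsc d Θ := by simp [sub_eq_add_neg]
  rw [this, evalTF_add StableTF.one ((StableTF.const _).mul hs) hz,
    evalTF_mul (StableTF.const _) hs hz]
  rw [evalTF_one, evalTF_C]
  push_cast
  ring

lemma c_stable {d : Fin n → ℝ} {ε : ℝ} (hd : euclNorm d ≤ ε) {Θ : Response n 1 1}
    (hΘ : SLSStable Θ) (hx : ε * hinfNorm Θ.N < 1) : StableTF (1 - tsc d Θ)⁻¹ := by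
  apply stable_inv
  intro z hz
  rw [evalTF_one_sub hΘ hz]
  have := evalTF_max (tsc_stable d hΘ) (tsc_sp d hΘ) (b := max (ε * hinfNorm Θ.N) (1/2))
    (lt_of_lt_of_le (by norm_num) (le_max_right _ _))
    (fun w hw => (tsc_bound hd hΘ hw).trans (le_max_left _ _)) hz
  have h1 : ‖evalTF (tsc d Θ) z‖ < 1 := lt_of_le_of_lt this (max_lt hx (by norm_num))
  intro h
  rw [← sub_eq_zero.mp h] at h1
  simp at h1

lemma c_bound {d : Fin n → ℝ} {ε : ℝ} (hd : euclNorm d ≤ ε) {Θ : Response n 1 1}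
    (hΘ : SLSStable Θ) (hx : ε * hinfNorm Θ.N < 1) {z : ℂ} (hz : ‖z‖ = 1) :
    ‖evalTF (1 - tsc d Θ)⁻¹ z‖ ≤ (1 - ε * hinfNorm Θ.N)⁻¹ := by
  have hc := c_stable hd hΘ hx
  have hs : StableTF (1 - tsc d Θ) := by
    have : (1 : TF) - tsc d Θ = 1 + RatFunc.C (-1) * tsc d Θ := by simp [sub_eq_add_neg]
    rw [this]
    exact StableTF.one.add ((StableTF.const _).mul (tsc_stable d hΘ))
  have h1 := evalTF_mul hc hs hz.ge
  rw [inv_mul_cancel₀ (one_sub_tsc_ne d hΘ), evalTF_one, evalTF_one_sub hΘ hz.ge] at h1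
  have h2 := congrArg norm h1
  rw [norm_one, norm_mul] at h2
  have h3 : 1 - ε * hinfNorm Θ.N ≤ ‖1 - evalTF (tsc d Θ) z‖ := by
    have := norm_sub_norm_le (1 : ℂ) (evalTF (tsc d Θ) z)
    rw [norm_one] at this
    have := tsc_bound hd hΘ hz
    linarith
  rw [le_inv_comm₀ (by
    by_contra h
    have : ‖evalTF (1 - tsc d Θ)⁻¹ z‖ = 0 := le_antisymm (not_lt.mp h) (norm_nonneg _)
    rw [this] at h2; simp at h2) (by linarith)]
  rwa [← eq_inv_of_mul_eq_one_right h2.symm]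

lemma sm_stable {d : Fin n → ℝ} {ε : ℝ} (hd : euclNorm d ≤ ε) {Θ : Response n 1 1}
    (hΘ : SLSStable Θ) (hx : ε * hinfNorm Θ.N < 1) : SLSStable (smPerturb d Θ) := by
  have hcs := c_stable hd hΘ hx
  have hcp := proper_inv_one_sub (tsc_sp d hΘ)
  have hne := one_sub_tsc_ne d hΘ
  obtain ⟨pR, pM, pN, hR, hM, hN, hL⟩ := hΘ
  have p1 : StrictlyProper (smPerturb d Θ).R := by
    rw [sm_R]
    exact sp_add pR (sp_smul hcp (sp_mul (fun i j => (hN i j).1) (rowN_sp _ pR)))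
  have p2 : StrictlyProper (smPerturb d Θ).M := by
    rw [sm_M]
    exact sp_add pM (sp_smul hcp (sp_mul (fun i j => (hL i j).1) (rowN_sp _ pR)))
  have p3 : StrictlyProper (smPerturb d Θ).N := by
    rw [sm_N hne]
    exact sp_smul hcp pN
  have s1 : MS (smPerturb d Θ).R := by
    rw [sm_R]
    exact hR.ms.add (MS.smul hcs (hN.ms.mul ((MS.rmap _).mul hR.ms)))
  have s2 : MS (smPerturb d Θ).M := by
    rw [sm_M]
    exact hM.ms.add (MS.smul hcs (hL.ms.mul ((MS.rmap _).mul hR.ms)))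
  have s3 : MS (smPerturb d Θ).N := by
    rw [sm_N hne]
    exact MS.smul hcs hN.ms
  have s4 : MS (smPerturb d Θ).L := by
    rw [sm_L hne]
    exact MS.smul hcs hL.ms
  refine ⟨p1, p2, p3, fun i j => ⟨(p1 i j).proper, s1 i j⟩, fun i j => ⟨(p2 i j).proper, s2 i j⟩,
    fun i j => ⟨(p3 i j).proper, s3 i j⟩, fun i j => ⟨?_, s4 i j⟩⟩
  rw [sm_L hne]
  exact hcp.mul (hL i j).1

lemma hinf_smul_le {m k : ℕ} {c : TF} {b : ℝ} (hc : StableTF c)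
    (hb : ∀ z : ℂ, ‖z‖ = 1 → ‖evalTF c z‖ ≤ b) {F : TMat m k} (hF : MS F) :
    hinfNorm (c • F) ≤ b * hinfNorm F := by
  apply hinf_le
  intro z hz
  rw [evalMat_smul hc hF hz.ge, specNorm_smul]
  exact mul_le_mul (hb z hz) (le_hinf hF hz) (specNorm_nonneg _) ((norm_nonneg _).trans (hb z hz))

lemma hinf_add_le {m k : ℕ} {F G : TMat m k} (hF : MS F) (hG : MS G) :
    hinfNorm (F + G) ≤ hinfNorm F + hinfNorm G := by
  apply hinf_le
  intro z hz
  rw [evalMat_add hF hG hz.ge]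
  exact (specNorm_add _ _).trans (add_le_add (le_hinf hF hz) (le_hinf hG hz))

lemma hinf_mul_le {l m k : ℕ} {F : TMat l m} {G : TMat m k} (hF : MS F) (hG : MS G) :
    hinfNorm (F * G) ≤ hinfNorm F * hinfNorm G := by
  apply hinf_le
  intro z hz
  rw [evalMat_mul hF hG hz.ge]
  exact (specNorm_mul _ _).trans
    (mul_le_mul (le_hinf hF hz) (le_hinf hG hz) (specNorm_nonneg _) hinf_nonneg)

lemma hinf_row {d : Fin n → ℝ} {ε : ℝ} (hd : euclNorm d ≤ ε) :
    hinfNorm (rmap (rowVec d)) ≤ ε := hinf_le fun z _ => (specNorm_row d z).trans hd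

/-- All the norm bounds for the perturbed response. -/
lemma sm_bounds {g d : Fin n → ℝ} {ε : ℝ} (hd : euclNorm d ≤ ε) {Θ : Response n 1 1}
    (hΘ : SLSStable Θ) (hx : ε * hinfNorm Θ.N < 1)
    (B₁ : Matrix (Fin n) (Fin nw) ℝ)
    (D₂₁ : Matrix (Fin 1) (Fin nw) ℝ) (D₁₁ : Matrix (Fin 2) (Fin nw) ℝ) :
    hinfNorm (smPerturb d Θ).N ≤ (1 - ε * hinfNorm Θ.N)⁻¹ * hinfNorm Θ.N ∧
    perfWeight (fun i => g i + d i) (smPerturb d Θ) ≤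
      (1 - ε * hinfNorm Θ.N)⁻¹ * perfWeight g Θ ∧
    hinfNorm (Wmat B₁ D₂₁ (smPerturb d Θ)) ≤ hinfNorm (Wmat B₁ D₂₁ Θ) +
      (1 - ε * hinfNorm Θ.N)⁻¹ * (hinfNorm Θ.N * (ε * hinfNorm (Wmat B₁ D₂₁ Θ))) ∧
    cost (fun i => g i + d i) B₁ D₂₁ D₁₁ (smPerturb d Θ) ≤ cost g B₁ D₂₁ D₁₁ Θ +
      (1 - ε * hinfNorm Θ.N)⁻¹ * (perfWeight g Θ * (ε * hinfNorm (Wmat B₁ D₂₁ Θ))) := by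
  have hcs := c_stable hd hΘ hx
  have hcb := fun z (hz : ‖z‖ = 1) => c_bound hd hΘ hx hz
  have hne := one_sub_tsc_ne d hΘ
  have hN : MS Θ.N := hΘ.2.2.2.2.2.1.ms
  have hV := Vcol_ms g hΘ
  have hW := Wmat_ms B₁ D₂₁ hΘ
  have hb0 : 0 ≤ (1 - ε * hinfNorm Θ.N)⁻¹ := inv_nonneg.mpr (by linarith)
  have hDW : MS (rmap (rowVec d) * Wmat B₁ D₂₁ Θ) := (MS.rmap _).mul hW
  have hDWb : hinfNorm (rmap (rowVec d) * Wmat B₁ D₂₁ Θ) ≤ ε * hinfNorm (Wmat B₁ D₂₁ Θ) :=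
    (hinf_mul_le (MS.rmap _) hW).trans (mul_le_mul_of_nonneg_right (hinf_row hd) hinf_nonneg)
  refine ⟨?_, ?_, ?_, ?_⟩
  · rw [sm_N hne]
    exact hinf_smul_le hcs hcb hN
  · rw [perf_eq, perf_eq, sm_Vcol hne]
    exact hinf_smul_le hcs hcb hV
  · rw [sm_Wmat]
    refine (hinf_add_le hW (MS.smul hcs (hN.mul hDW))).trans (add_le_add_right ?_ _)
    refine (hinf_smul_le hcs hcb (hN.mul hDW)).trans (mul_le_mul_of_nonneg_left ?_ hb0)
    exact (hinf_mul_le hN hDW).trans (mul_le_mul_of_nonneg_left hDWb hinf_nonneg)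
  · rw [perf_eq]
    change hinfNorm (Cmat (fun i => g i + d i) B₁ D₂₁ D₁₁ (smPerturb d Θ)) ≤
      hinfNorm (Cmat g B₁ D₂₁ D₁₁ Θ) + _
    rw [sm_Cmat B₁ D₂₁ D₁₁ hne]
    refine (hinf_add_le (Cmat_ms g B₁ D₂₁ D₁₁ hΘ) (MS.smul hcs (hV.mul hDW))).trans
      (add_le_add_right ?_ _)
    refine (hinf_smul_le hcs hcb (hV.mul hDW)).trans (mul_le_mul_of_nonneg_left ?_ hb0)
    exact (hinf_mul_le hV hDW).trans (mul_le_mul_of_nonneg_left hDWb hinf_nonneg)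

lemma R_unit {g : Fin n → ℝ} {Θ : Response n 1 1}
    (h : SLSConstraints (shiftMat n) (e1 n) (rowVec g) Θ) : IsUnit Θ.R.det := by
  obtain ⟨h1, -, -, -, hs⟩ := h
  have h1' : zIA (shiftMat n) * Θ.R = 1 + rmap (e1 n) * Θ.M := by rw [← h1]; abel
  have h2 := congrArg Matrix.det h1'
  rw [Matrix.det_mul, Matrix.det_one_add_mul_comm, Matrix.det_fin_one] at h2
  rw [isUnit_iff_ne_zero]
  intro h0
  rw [h0, mul_zero] at h2
  have hsp : StrictlyProperTF ((Θ.M * rmap (e1 n)) 0 0) := by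
    rw [Matrix.mul_apply]
    refine StrictlyProperTF.sum _ fun l _ => ?_
    rw [mul_comm]
    exact StrictlyProperTF.mul (ProperTF.const _) (hs.2.1 _ l)
  exact one_add_ne_zero hsp (by simpa using h2.symm)

/-- Deterministic part of the theorem. -/
lemma det_main (g d : Fin n → ℝ) (B₁ : Matrix (Fin n) (Fin nw) ℝ)
    (D₂₁ : Matrix (Fin 1) (Fin nw) ℝ) (D₁₁ : Matrix (Fin 2) (Fin nw) ℝ)
    {ε : ℝ} (hd : euclNorm d ≤ ε) (Θ₀ : Response n 1 1)
    (hΘ₀ : OptimalResponse g B₁ D₂₁ D₁₁ Θ₀)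
    (hε : ε * hinfNorm Θ₀.N < 1 / 4)
    (Θt : Response n 1 1) (α : ℝ)
    (hopt : RobustOptimal (fun i => g i + d i) B₁ D₂₁ D₁₁ ε Θt α) :
    ∃ Θhat : Response n 1 1,
        Achieves (shiftMat n) (e1 n) (rowVec g) (controller Θt) Θhat ∧
        SLSStable Θhat ∧
        cost g B₁ D₂₁ D₁₁ Θhat - cost g B₁ D₂₁ D₁₁ Θ₀ ≤
          4 * ε * perfWeight g Θ₀ * hinfNorm (Θ₀.R * rmap B₁ + Θ₀.N * rmap D₂₁) := by
  have hε0 : 0 ≤ ε := (Real.sqrt_nonneg _).trans hd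
  obtain ⟨⟨hα, hSLS, hfeas⟩, hmin⟩ := hopt
  -- upper bound on the robust optimum
  have hst0 := hΘ₀.1.2.2.2.2
  have hP0 := perf_pos g hst0
  obtain ⟨b1, b2, b3, b4⟩ := sm_bounds (g := g) hd hst0 (by linarith) B₁ D₂₁ D₁₁
  have hst' := sm_stable hd hst0 (by linarith)
  have hne0 := one_sub_tsc_ne d hst0
  obtain ⟨q1, q2, q3, q4, -⟩ := hΘ₀.1
  obtain ⟨r1, r2, r3, r4⟩ := sm_eqs (d := d) hne0 _ _ q1 q2 q3 q4
  set N₀ := hinfNorm Θ₀.N with hN₀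
  set P₀ := perfWeight g Θ₀
  set W₀ := hinfNorm (Wmat B₁ D₂₁ Θ₀) with hW₀
  have hN0 : 0 ≤ N₀ := hinf_nonneg
  have hW0 : 0 ≤ W₀ := hinf_nonneg
  have hx0 : 0 ≤ ε * N₀ := mul_nonneg hε0 hN0
  have hy : 0 < 1 - ε * N₀ := by linarith
  have hy2 : 0 < 1 - 2 * (ε * N₀) := by linarith
  have hfeas' : RobustFeasible (fun i => g i + d i) ε (smPerturb d Θ₀)
      (P₀ / (1 - 2 * (ε * N₀))) := by
    refine ⟨by positivity, ⟨r1, r2, r3, r4, hst'⟩, ?_⟩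
    calc _ ≤ ε * (P₀ / (1 - 2 * (ε * N₀))) * ((1 - ε * N₀)⁻¹ * N₀) + (1 - ε * N₀)⁻¹ * P₀ := by
          gcongr
      _ = (ε * N₀) * (P₀ / (1 - 2 * (ε * N₀))) * (1 - ε * N₀)⁻¹ + (1 - ε * N₀)⁻¹ * P₀ := by ring
      _ = P₀ / (1 - 2 * (ε * N₀)) := real_aux1 P₀ hy.ne' hy2.ne'
  have hQ := hmin _ _ hfeas'
  have hQ' : Qval (fun i => g i + d i) B₁ D₂₁ D₁₁ ε (smPerturb d Θ₀) (P₀ / (1 - 2 * (ε * N₀)))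
      ≤ cost g B₁ D₂₁ D₁₁ Θ₀ + 4 * ε * P₀ * W₀ := by
    unfold Qval
    change _ + _ * hinfNorm (Wmat B₁ D₂₁ (smPerturb d Θ₀)) ≤ _
    calc _ ≤ (cost g B₁ D₂₁ D₁₁ Θ₀ + (1 - ε * N₀)⁻¹ * (P₀ * (ε * W₀))) +
          ε * (P₀ / (1 - 2 * (ε * N₀))) * (W₀ + (1 - ε * N₀)⁻¹ * (N₀ * (ε * W₀))) := by
          gcongr
      _ = cost g B₁ D₂₁ D₁₁ Θ₀ + ((1 - ε * N₀)⁻¹ * (P₀ * (ε * W₀)) +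
          ε * (P₀ / (1 - 2 * (ε * N₀))) * (W₀ + (1 - ε * N₀)⁻¹ * ((ε * N₀) * W₀))) := by ring
      _ = cost g B₁ D₂₁ D₁₁ Θ₀ + ε * P₀ * W₀ * (2 / (1 - 2 * (ε * N₀))) := by
          rw [real_aux2 P₀ ε W₀ hy.ne' hy2.ne']
      _ ≤ cost g B₁ D₂₁ D₁₁ Θ₀ + ε * P₀ * W₀ * 4 := by
          gcongr
          rw [div_le_iff₀ hy2]
          linarith
      _ = _ := by ring
  -- true closed loop
  have hst := hSLS.2.2.2.2
  have hPt := perf_pos (fun i => g i + d i) hst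
  have hNt : 0 ≤ hinfNorm Θt.N := hinf_nonneg
  have hxt : ε * hinfNorm Θt.N < 1 := by
    by_contra hcon
    have : α * 1 ≤ α * (ε * hinfNorm Θt.N) := mul_le_mul_of_nonneg_left (not_lt.mp hcon) hα.le
    nlinarith
  have hd' : euclNorm (fun i => - d i) ≤ ε := by simpa [euclNorm] using hd
  have hgg : (fun i => (g i + d i) + - d i) = g := by funext i; ring
  have hne := one_sub_tsc_ne (fun i => - d i) hst
  obtain ⟨-, -, -, c4⟩ := sm_bounds (g := fun i => g i + d i) hd' hst hxt B₁ D₂₁ D₁₁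
  have hRu := R_unit hSLS
  obtain ⟨p1, p2, p3, p4, -⟩ := hSLS
  obtain ⟨s1, s2, -, -⟩ := sm_eqs (d := fun i => - d i) hne _ _ p1 p2 p3 p4
  obtain ⟨k1, k2⟩ := sm_ctrl (d := fun i => - d i) hne _ hRu p3 p4
  rw [hgg] at c4 k1 k2
  refine ⟨smPerturb (fun i => - d i) Θt, ⟨?_, sub_eq_zero.mp s2, k1, k2⟩,
    sm_stable hd' hst hxt, ?_⟩
  · rw [← s1]; abel
  have hWt : 0 ≤ hinfNorm (Wmat B₁ D₂₁ Θt) := hinf_nonneg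
  have hyt : 0 < 1 - ε * hinfNorm Θt.N := by linarith
  have hfin := real_aux3 hyt hε0 hWt hfeas
  unfold Qval at hQ
  exact real_aux4 c4 hfin hQ hQ'

end bounds

end SLS

namespace SLS

section prob

open scoped NNReal

/-- Law of a sum of independent centred Gaussian functions of the coordinates. -/
lemma map_pi_sum {ι : Type} [Fintype ι] {X : ι → Type} [∀ i, MeasurableSpace (X i)]
    (μ : ∀ i, Measure (X i)) [∀ i, IsProbabilityMeasure (μ i)] (f : ∀ i, X i → ℝ)
    (hf : ∀ i, Measurable (f i)) (v : ι → ℝ≥0)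
    (h : ∀ i, (μ i).map (f i) = gaussianReal 0 (v i)) :
    (Measure.pi μ).map (fun x => ∑ i, f i (x i)) = gaussianReal 0 (∑ i, v i) := by
  classical
  have hind : iIndepFun (fun i (x : ∀ i, X i) => f i (x i)) (Measure.pi μ) :=
    iIndepFun_pi fun i => (hf i).aemeasurable
  have hm : ∀ i, Measurable (fun (x : ∀ i, X i) => f i (x i)) := fun i =>
    (hf i).comp (measurable_pi_apply i)
  have hlaw : ∀ i, (Measure.pi μ).map (fun x => f i (x i)) = gaussianReal 0 (v i) := by
    intro i
    rw [← h i, ← (measurePreserving_eval μ i).map_eq, Measure.map_map (hf i)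
      (measurable_pi_apply i)]
    rfl
  have key : ∀ s : Finset ι, (Measure.pi μ).map (∑ i ∈ s, fun (x : ∀ i, X i) => f i (x i)) =
      gaussianReal 0 (∑ i ∈ s, v i) := by
    intro s
    induction s using Finset.induction_on with
    | empty =>
      simp only [Finset.sum_empty, gaussianReal_zero_var]
      change Measure.map (fun _ => (0 : ℝ)) _ = _
      rw [Measure.map_const]
      simp
    | insert a s ha ih =>
      rw [Finset.sum_insert ha, Finset.sum_insert ha, add_comm, add_comm (v a)]
      have := gaussianReal_add_gaussianReal_of_indepFun
        (hind.indepFun_finsetSum_of_notMem hm ha) ih (hlaw a)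
      simpa using this
  have := key Finset.univ
  convert this using 2
  funext x
  simp

/-- Law of a linear form of the i.i.d. noise. -/
lemma map_linear (mE T : ℕ) (σ2 : ℝ) (a : Fin mE → Fin T → ℝ) :
    (iidGaussianLaw mE T σ2).map (fun x => ∑ k, ∑ t, a k t * x k t) =
      gaussianReal 0 (∑ k, ∑ t, NNReal.mk (a k t ^ 2) (sq_nonneg _) * σ2.toNNReal) := by
  unfold iidGaussianLaw
  refine map_pi_sum _ (fun k (x : Fin T → ℝ) => ∑ t, a k t * x t) (fun k => by fun_prop) _ ?_
  intro k
  refine map_pi_sum _ (fun t (x : ℝ) => a k t * x) (fun k => by fun_prop) _ ?_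
  intro t
  rw [gaussianReal_map_const_mul]
  simp

lemma gauss_exp {v : ℝ≥0} (hv : v ≠ 0) {q : ℝ} (hq : 0 < q) :
    ∫⁻ x, ENNReal.ofReal (Real.exp ((1 - q) / 2 * (x ^ 2 / v))) ∂(gaussianReal 0 v) =
      ENNReal.ofReal (Real.sqrt q)⁻¹ := by
  have hv' : (0 : ℝ) < v := by positivity
  rw [gaussianReal_of_var_ne_zero _ hv,
    lintegral_withDensity_eq_lintegral_mul _ (measurable_gaussianPDF _ _) (by fun_prop)]
  have h1 : ∀ x : ℝ, (gaussianPDF 0 v * fun x =>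
      ENNReal.ofReal (Real.exp ((1 - q) / 2 * (x ^ 2 / v)))) x =
      ENNReal.ofReal ((Real.sqrt (2 * Real.pi * v))⁻¹ * Real.exp (-(q / (2 * v)) * x ^ 2)) := by
    intro x
    rw [Pi.mul_apply, gaussianPDF, gaussianPDFReal, ← ENNReal.ofReal_mul (by positivity),
      mul_assoc, ← Real.exp_add]
    congr 3
    field_simp
    ring
  simp_rw [h1]
  have hb : 0 < q / (2 * v) := by positivity
  rw [← ofReal_integral_eq_lintegral_ofReal ((integrable_exp_neg_mul_sq hb).const_mul _)
    (Filter.Eventually.of_forall fun x => by positivity), integral_const_mul, integral_gaussian]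
  congr 1
  rw [← Real.sqrt_inv, ← Real.sqrt_inv, ← Real.sqrt_mul (by positivity)]
  congr 1
  field_simp

lemma jensen_exp {ι : Type} [Fintype ι] (v y : ι → ℝ) (hv : ∀ i, 0 < v i)
    (hV : 0 < ∑ i, v i) (s : ℝ) :
    Real.exp (s * ((∑ i, y i) / ∑ i, v i)) ≤
      ∑ i, (v i / ∑ i, v i) * Real.exp (s * (y i / v i)) := by
  have h := convexOn_exp.map_sum_le (t := Finset.univ) (w := fun i => v i / ∑ i, v i)
    (p := fun i => s * (y i / v i)) (fun i _ => (div_pos (hv i) hV).le)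
    (by rw [← Finset.sum_div, div_self hV.ne']) (fun i _ => Set.mem_univ _)
  simp only [smul_eq_mul] at h
  refine le_trans (le_of_eq ?_) h
  congr 1
  rw [Finset.sum_div, Finset.mul_sum]
  refine Finset.sum_congr rfl fun i _ => ?_
  have := (hv i).ne'
  field_simp

lemma exp_tail (t : ℝ) :
    (1 + t) ≤ Real.exp (-(t ^ 2 / 2)) * Real.exp (((1 + t) ^ 2 - 1) / 2) := by
  rw [← Real.exp_add]
  have : -(t ^ 2 / 2) + ((1 + t) ^ 2 - 1) / 2 = t := by ring
  rw [this]
  linarith [Real.add_one_le_exp t]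

lemma gauss_tail {Ω : Type} [MeasurableSpace Ω] (μ : Measure Ω)
    {ι : Type} [Fintype ι] (X : ι → Ω → ℝ) (hX : ∀ i, Measurable (X i)) (v : ι → ℝ≥0)
    (hv : ∀ i, v i ≠ 0) (hlaw : ∀ i, μ.map (X i) = gaussianReal 0 (v i)) {w t : ℝ}
    (ht : 0 ≤ t) (hw : ∑ i, (v i : ℝ) ≤ w ^ 2) :
    μ {x | (w * (1 + t)) ^ 2 < ∑ i, X i x ^ 2} ≤ ENNReal.ofReal (Real.exp (-(t ^ 2 / 2))) := by
  rcases isEmpty_or_nonempty ι with hι | hι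
  · have : {x | (w * (1 + t)) ^ 2 < ∑ i, X i x ^ 2} = ∅ := by
      ext x
      simp
      positivity
    rw [this]
    simp
  have hv' : ∀ i, (0 : ℝ) < v i := fun i => by have := hv i; positivity
  have hV : 0 < ∑ i, (v i : ℝ) := Finset.sum_pos (fun i _ => hv' i) Finset.univ_nonempty
  set V := ∑ i, (v i : ℝ) with hVdef
  set q : ℝ := ((1 + t) ^ 2)⁻¹ with hqdef
  have hq : 0 < q := by positivity
  have hsq : (Real.sqrt q)⁻¹ = 1 + t := by
    rw [hqdef, Real.sqrt_inv, inv_inv, Real.sqrt_sq (by positivity)]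
  have hs0 : 0 ≤ (1 - q) / 2 := by
    have : q ≤ 1 := by
      rw [hqdef]
      apply inv_le_one_of_one_le₀
      nlinarith
    linarith
  set E := {x | (w * (1 + t)) ^ 2 < ∑ i, X i x ^ 2} with hE
  have hint : ∀ i, ∫⁻ x, ENNReal.ofReal (Real.exp ((1 - q) / 2 * (X i x ^ 2 / v i))) ∂μ =
      ENNReal.ofReal (1 + t) := by
    intro i
    rw [← hsq, ← gauss_exp (hv i) hq, ← hlaw i, lintegral_map (by fun_prop) (hX i)]
  have hmark := mul_meas_ge_le_lintegral (μ := μ)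
    (f := fun x => ∑ i, ENNReal.ofReal (v i / V) *
      ENNReal.ofReal (Real.exp ((1 - q) / 2 * (X i x ^ 2 / v i))))
    (by fun_prop) (ENNReal.ofReal (Real.exp (((1 + t) ^ 2 - 1) / 2)))
  have hrhs : ∫⁻ x, ∑ i, ENNReal.ofReal (v i / V) *
      ENNReal.ofReal (Real.exp ((1 - q) / 2 * (X i x ^ 2 / v i))) ∂μ = ENNReal.ofReal (1 + t) := by
    rw [lintegral_finsetSum _ (by fun_prop)]
    have : ∀ i, ∫⁻ x, ENNReal.ofReal (v i / V) *
      ENNReal.ofReal (Real.exp ((1 - q) / 2 * (X i x ^ 2 / v i))) ∂μ =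
        ENNReal.ofReal (v i / V) * ENNReal.ofReal (1 + t) := by
      intro i
      rw [lintegral_const_mul _ (by fun_prop), hint i]
    simp_rw [this]
    rw [← Finset.sum_mul, ← ENNReal.ofReal_sum_of_nonneg
      (fun i _ => (div_pos (hv' i) hV).le), ← Finset.sum_div, ← hVdef, div_self hV.ne']
    simp
  rw [hrhs] at hmark
  have hsub : E ⊆ {x | ENNReal.ofReal (Real.exp (((1 + t) ^ 2 - 1) / 2)) ≤
      ∑ i, ENNReal.ofReal (v i / V) *
      ENNReal.ofReal (Real.exp ((1 - q) / 2 * (X i x ^ 2 / v i)))} := by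
    intro x hx
    have hx' : (w * (1 + t)) ^ 2 < ∑ i, X i x ^ 2 := hx
    have hj := jensen_exp (fun i => (v i : ℝ)) (fun i => X i x ^ 2) hv' hV ((1 - q) / 2)
    simp only [Set.mem_ofPred_eq]
    have e1 : ∑ i, ENNReal.ofReal (v i / V) *
        ENNReal.ofReal (Real.exp ((1 - q) / 2 * (X i x ^ 2 / v i))) =
        ENNReal.ofReal (∑ i, (v i / V) * Real.exp ((1 - q) / 2 * (X i x ^ 2 / v i))) := by
      rw [ENNReal.ofReal_sum_of_nonneg
        (fun i _ => mul_nonneg (div_pos (hv' i) hV).le (Real.exp_pos _).le)]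
      refine Finset.sum_congr rfl fun i _ => ?_
      rw [ENNReal.ofReal_mul (div_pos (hv' i) hV).le]
    rw [e1]
    apply ENNReal.ofReal_le_ofReal
    refine le_trans (Real.exp_le_exp.mpr ?_) hj
    have e2 : (1 + t) ^ 2 ≤ (∑ i, X i x ^ 2) / V := by
      rw [le_div_iff₀ hV]
      calc (1 + t) ^ 2 * V ≤ (1 + t) ^ 2 * w ^ 2 := by gcongr
        _ = (w * (1 + t)) ^ 2 := by ring
        _ ≤ _ := hx'.le
    calc ((1 + t) ^ 2 - 1) / 2 = (1 - q) / 2 * (1 + t) ^ 2 := by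
          rw [hqdef]
          have : (1 + t) ^ 2 ≠ 0 := by positivity
          field_simp
      _ ≤ _ := by gcongr
  have h1 : ENNReal.ofReal (Real.exp (((1 + t) ^ 2 - 1) / 2)) * μ E ≤ ENNReal.ofReal (1 + t) :=
    le_trans (by gcongr) hmark
  have h2 : ENNReal.ofReal (1 + t) ≤ ENNReal.ofReal (Real.exp (((1 + t) ^ 2 - 1) / 2)) *
      ENNReal.ofReal (Real.exp (-(t ^ 2 / 2))) := by
    rw [← ENNReal.ofReal_mul (Real.exp_pos _).le, mul_comm]
    exact ENNReal.ofReal_le_ofReal (exp_tail t)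
  exact (ENNReal.mul_le_mul_iff_right (by simp [Real.exp_pos]) ENNReal.ofReal_ne_top).mp
    (h1.trans h2)

end prob

end SLS

namespace SLS

section final

open scoped NNReal

/-- The least-squares operator. -/
def lsOp {T mE : ℕ} (u : Fin mE → Fin T → ℝ) : Matrix (Fin T) (Fin mE × Fin T) ℝ :=
  (ZtZ u)⁻¹ * (Zmat u)ᵀ

lemma lsOp_mul {T mE : ℕ} {u : Fin mE → Fin T → ℝ} (h : IsUnit (ZtZ u).det) :
    lsOp u * Zmat u = 1 := by
  rw [lsOp, Matrix.mul_assoc]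
  exact Matrix.nonsing_inv_mul _ h

lemma lsOp_mul_transpose {T mE : ℕ} {u : Fin mE → Fin T → ℝ} (h : IsUnit (ZtZ u).det) :
    lsOp u * (lsOp u)ᵀ = (ZtZ u)⁻¹ := by
  have hs : (ZtZ u)ᵀ = ZtZ u := by
    rw [ZtZ, Matrix.transpose_mul, Matrix.transpose_transpose]
  conv_lhs => rw [lsOp]
  rw [Matrix.transpose_mul, Matrix.transpose_transpose, Matrix.transpose_nonsing_inv, hs,
    ← Matrix.mul_assoc, Matrix.mul_assoc (ZtZ u)⁻¹]
  change (ZtZ u)⁻¹ * ZtZ u * _ = _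
  rw [Matrix.nonsing_inv_mul _ h, Matrix.one_mul]

lemma coarse_eq {r T mE : ℕ} (hrT : r ≤ T) {u : Fin mE → Fin T → ℝ} (h : IsUnit (ZtZ u).det)
    (g : Fin (r - 1) → ℝ) (x : Fin mE → Fin T → ℝ) (i : Fin (r - 1)) :
    coarseEst hrT u g x i = g i + ∑ k, ∑ t,
      lsOp u ⟨(i : ℕ) + 1, by have := i.isLt; omega⟩ (k, t) * x k t := by
  have h1 : (fun pr : Fin mE × Fin T => ((toep (u pr.1)).mulVec (pad hrT g) + x pr.1) pr.2) =
      (Zmat u).mulVec (pad hrT g) + fun pr => x pr.1 pr.2 := by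
    funext pr
    rfl
  have h2 : pad hrT g ⟨(i : ℕ) + 1, by have := i.isLt; omega⟩ = g i := by
    have := i.isLt
    rw [pad, dif_pos ⟨by simp, by simp; omega⟩]
    congr 1
  rw [coarseEst, lsEst, h1, Matrix.mulVec_add, Matrix.mulVec_mulVec]
  change ((lsOp u * Zmat u).mulVec _ + (lsOp u).mulVec _) _ = _
  rw [lsOp_mul h, Matrix.one_mulVec, Pi.add_apply, h2]
  congr 1
  rw [Matrix.mulVec, dotProduct, Fintype.sum_prod_type]

lemma sum_shift {r : ℕ} (f : Fin r → ℝ) (hf : ∀ i, 0 ≤ f i) :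
    ∑ i : Fin (r - 1), f ⟨(i : ℕ) + 1, by have := i.isLt; omega⟩ ≤ ∑ j, f j := by
  cases r with
  | zero => simp
  | succ n =>
    rw [Fin.sum_univ_succ]
    change ∑ i : Fin n, f i.succ ≤ _
    linarith [hf 0]

lemma prob_main {r T mE : ℕ} (hrT : r ≤ T) {u : Fin mE → Fin T → ℝ} (h : IsUnit (ZtZ u).det)
    (g : Fin (r - 1) → ℝ) {σ η b : ℝ} (hσ : 0 < σ) (hη0 : 0 < η) (hη1 : η < 1) (hb : 0 ≤ b)
    (hS : (((ZtZ u)⁻¹).submatrix (Fin.castLE hrT) (Fin.castLE hrT)).trace ≤ 4 * b) :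
    iidGaussianLaw mE T (σ ^ 2) {x | 2 * Real.sqrt (σ ^ 2 * b) *
      (1 + Real.sqrt (2 * Real.log (1 / η))) < euclNorm (fun i => coarseEst hrT u g x i - g i)} ≤
      ENNReal.ofReal η := by
  set t := Real.sqrt (2 * Real.log (1 / η)) with ht
  have ht0 : 0 ≤ t := Real.sqrt_nonneg _
  have hlog : 0 ≤ Real.log (1 / η) := Real.log_nonneg (by rw [le_div_iff₀ hη0]; linarith)
  have hexp : Real.exp (-(t ^ 2 / 2)) = η := by
    rw [ht, Real.sq_sqrt (by positivity), mul_div_cancel_left₀ _ two_ne_zero, one_div,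
      Real.log_inv, neg_neg, Real.exp_log hη0]
  set w := 2 * Real.sqrt (σ ^ 2 * b) with hw
  have hw0 : 0 ≤ w := by positivity
  have hw2 : w ^ 2 = σ ^ 2 * (4 * b) := by
    rw [hw, mul_pow, Real.sq_sqrt (by positivity)]
    ring
  set a : Fin (r - 1) → Fin mE → Fin T → ℝ := fun i k t =>
    lsOp u ⟨(i : ℕ) + 1, by have := i.isLt; omega⟩ (k, t) with ha
  set v : Fin (r - 1) → ℝ≥0 := fun i =>
    ∑ k, ∑ t, NNReal.mk (a i k t ^ 2) (sq_nonneg _) * (σ ^ 2).toNNReal with hv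
  have hdiag : ∀ j : Fin T, (ZtZ u)⁻¹ j j = ∑ k, ∑ t, lsOp u j (k, t) ^ 2 := by
    intro j
    rw [← lsOp_mul_transpose h, Matrix.mul_apply, Fintype.sum_prod_type]
    refine Finset.sum_congr rfl fun k _ => Finset.sum_congr rfl fun t _ => ?_
    rw [Matrix.transpose_apply, sq]
  have hvc : ∀ i, (v i : ℝ) = σ ^ 2 * (ZtZ u)⁻¹ ⟨(i : ℕ) + 1, by have := i.isLt; omega⟩
      ⟨(i : ℕ) + 1, by have := i.isLt; omega⟩ := by
    intro i
    rw [hdiag, hv]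
    push_cast
    rw [Finset.mul_sum]
    refine Finset.sum_congr rfl fun k _ => ?_
    rw [Finset.mul_sum]
    refine Finset.sum_congr rfl fun t _ => ?_
    rw [Real.coe_toNNReal _ (sq_nonneg _), mul_comm]
  have hdn : ∀ j : Fin T, 0 ≤ (ZtZ u)⁻¹ j j := fun j => by
    rw [hdiag]
    positivity
  have hdp : ∀ j : Fin T, (ZtZ u)⁻¹ j j ≠ 0 := by
    intro j h0
    rw [hdiag, ← Fintype.sum_prod_type (f := fun p => lsOp u j p ^ 2),
      Finset.sum_eq_zero_iff_of_nonneg (fun _ _ => sq_nonneg _)] at h0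
    have h1 := congrFun (congrFun (lsOp_mul h) j) j
    rw [Matrix.mul_apply, Finset.sum_eq_zero, Matrix.one_apply_eq] at h1
    · exact zero_ne_one h1
    · intro p hp
      rw [pow_eq_zero_iff two_ne_zero |>.mp (h0 p hp), zero_mul]
  have hvn : ∀ i, v i ≠ 0 := by
    intro i h0
    have := hvc i
    rw [h0] at this
    exact mul_ne_zero (pow_ne_zero 2 hσ.ne') (hdp _) this.symm
  have hsum : ∑ i, (v i : ℝ) ≤ w ^ 2 := by
    simp_rw [hvc]
    rw [← Finset.mul_sum, hw2]
    refine mul_le_mul_of_nonneg_left (le_trans ?_ hS) (sq_nonneg _)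
    exact sum_shift (fun j : Fin r => (ZtZ u)⁻¹ (Fin.castLE hrT j) (Fin.castLE hrT j))
      (fun j => hdn _)
  have key := gauss_tail (iidGaussianLaw mE T (σ ^ 2))
    (fun i x => ∑ k, ∑ t, a i k t * x k t) (fun i => by fun_prop) v hvn
    (fun i => map_linear mE T (σ ^ 2) (a i)) ht0 hsum
  rw [hexp] at key
  refine le_trans (measure_mono fun x hx => ?_) key
  have hx' : w * (1 + t) < euclNorm (fun i => coarseEst hrT u g x i - g i) := hx
  change (w * (1 + t)) ^ 2 < ∑ i, (∑ k, ∑ t, a i k t * x k t) ^ 2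
  rw [euclNorm, Real.lt_sqrt (by positivity)] at hx'
  refine lt_of_lt_of_le hx' (le_of_eq ?_)
  refine Finset.sum_congr rfl fun i _ => ?_
  rw [coarse_eq hrT h, add_sub_cancel_left]

end final

end SLS

open SLS MeasureTheory

/-- end-to-end Coarse-ID control: with `Θ₀` a minimizer of `J(g, ·)` over
SLS-feasible responses for the true FIR plant `(Z, e₁, gᵀ)`, `g̃` the coarse-grained
least-squares estimate from `m` experiments with unit-`ℓ_p`-ball inputs chosen so that
`Tr(S) ≤ 4·log 2·r^{2/max(p,2)}/m`, and `(Θ̃*, α*)` a minimizer of the robust SLS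
problem for `g̃` with `ε = 2√(log 2·σ²r^{2/max(p,2)}/m)(1 + √(2 log(1/η)))` satisfying
`ε < 1/(4‖N₀‖)`, then with probability at least `1 − η` the controller
`K̃* = L̃* − M̃*R̃*⁻¹Ñ*` internally stabilizes the true plant and its achieved
closed-loop response `Θ̂*` satisfies
`J(g, Θ̂*) − J(g, Θ₀) ≤ 8√(log 2·σ²r^{2/max(p,2)}/m)(1 + √(2 log(1/η)))·
‖[1 + gᵀN₀; L₀]‖·‖R₀B₁ + N₀D₂₁‖`. -/
theorem statement_0 (r T mE nw : ℕ) (hrT : r ≤ T)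
    (g : Fin (r - 1) → ℝ)
    (B₁ : Matrix (Fin (r - 1)) (Fin nw) ℝ) (D₂₁ : Matrix (Fin 1) (Fin nw) ℝ)
    (D₁₁ : Matrix (Fin 2) (Fin nw) ℝ)
    (σ η : ℝ) (hσ : 0 < σ) (hη0 : 0 < η) (hη1 : η < 1)
    (p : ℝ≥0∞) (hp : 1 ≤ p)
    {Ω : Type} [MeasurableSpace Ω] (P : Measure Ω) [IsProbabilityMeasure P]
    (ξ : Ω → Fin mE → Fin T → ℝ)
    (hlaw : Measure.map ξ P = iidGaussianLaw mE T (σ ^ 2))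
    (u : Fin mE → Fin T → ℝ)
    (hu : ∀ i, lpNorm p (u i) ≤ 1)
    (hinv : IsUnit (ZtZ u).det)
    (hS : (((ZtZ u)⁻¹).submatrix (Fin.castLE hrT) (Fin.castLE hrT)).trace ≤
      4 * Real.log 2 * rExp p r / mE)
    (Θ₀ : Response (r - 1) 1 1)
    (hΘ₀ : OptimalResponse g B₁ D₂₁ D₁₁ Θ₀)
    (ε : ℝ)
    (hεdef : ε = 2 * Real.sqrt (Real.log 2 * σ ^ 2 * rExp p r / mE) *
      (1 + Real.sqrt (2 * Real.log (1 / η))))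
    (hεsmall : ε < 1 / (4 * hinfNorm Θ₀.N))
    (Θt : Ω → Response (r - 1) 1 1) (α : Ω → ℝ)
    (hopt : ∀ ω, RobustOptimal (coarseEst hrT u g (ξ ω)) B₁ D₂₁ D₁₁ ε (Θt ω) (α ω)) :
    ENNReal.ofReal (1 - η) ≤
      P {ω | ∃ Θhat : Response (r - 1) 1 1,
        Achieves (shiftMat (r - 1)) (e1 (r - 1)) (rowVec g) (controller (Θt ω)) Θhat ∧
        SLSStable Θhat ∧
        cost g B₁ D₂₁ D₁₁ Θhat - cost g B₁ D₂₁ D₁₁ Θ₀ ≤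
          8 * Real.sqrt (Real.log 2 * σ ^ 2 * rExp p r / mE) *
            (1 + Real.sqrt (2 * Real.log (1 / η))) * perfWeight g Θ₀ *
            hinfNorm (Θ₀.R * rmap B₁ + Θ₀.N * rmap D₂₁)} := by
  set b : ℝ := Real.log 2 * rExp p r / mE with hb
  have hr0 : 0 ≤ rExp p r := Real.rpow_nonneg (Nat.cast_nonneg _) _
  have hl2 : 0 ≤ Real.log 2 := Real.log_nonneg (by norm_num)
  have hb0 : 0 ≤ b := by positivity
  have hbe : Real.log 2 * σ ^ 2 * rExp p r / mE = σ ^ 2 * b := by rw [hb]; ring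
  have hSb : (((ZtZ u)⁻¹).submatrix (Fin.castLE hrT) (Fin.castLE hrT)).trace ≤ 4 * b := by
    refine hS.trans (le_of_eq ?_)
    rw [hb]
    ring
  rw [hbe] at hεdef ⊢
  have hpr := prob_main hrT hinv g hσ hη0 hη1 hb0 hSb
  rw [← hεdef] at hpr
  have hε0 : 0 ≤ ε := by rw [hεdef]; positivity
  have hN0 : 0 < hinfNorm Θ₀.N := by
    refine lt_of_le_of_ne hinf_nonneg fun h0 => ?_
    rw [← h0] at hεsmall
    simp at hεsmall
    linarith
  have hεN : ε * hinfNorm Θ₀.N < 1 / 4 := by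
    rw [lt_div_iff₀ (by positivity)] at hεsmall
    linarith
  have hprob : IsProbabilityMeasure (iidGaussianLaw mE T (σ ^ 2)) := by
    unfold iidGaussianLaw
    infer_instance
  have hξ : AEMeasurable ξ P := by
    apply AEMeasurable.of_map_ne_zero
    rw [hlaw]
    exact hprob.ne_zero
  set S : Set (Fin mE → Fin T → ℝ) :=
    {x | ε < euclNorm (fun i => coarseEst hrT u g x i - g i)} with hSdef
  have hmeas : MeasurableSet S := by
    apply measurableSet_lt measurable_const
    unfold euclNorm
    have : (fun x => Real.sqrt (∑ i, (coarseEst hrT u g x i - g i) ^ 2)) = fun x =>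
        Real.sqrt (∑ i : Fin (r - 1), (∑ k, ∑ t,
          lsOp u ⟨(i : ℕ) + 1, by have := i.isLt; omega⟩ (k, t) * x k t) ^ 2) := by
      funext x
      congr 1
      refine Finset.sum_congr rfl fun i _ => ?_
      rw [coarse_eq hrT hinv, add_sub_cancel_left]
    rw [this]
    fun_prop
  have hcompl : ENNReal.ofReal (1 - η) ≤ P (ξ ⁻¹' Sᶜ) := by
    rw [← Measure.map_apply_of_aemeasurable hξ hmeas.compl, hlaw, prob_compl_eq_one_sub hmeas,
      ENNReal.ofReal_sub _ hη0.le, ENNReal.ofReal_one]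
    exact tsub_le_tsub_left hpr _
  refine hcompl.trans (measure_mono fun ω hω => ?_)
  have hd : euclNorm (fun i => coarseEst hrT u g (ξ ω) i - g i) ≤ ε := not_lt.mp hω
  have hgd : coarseEst hrT u g (ξ ω) =
      fun i => g i + (coarseEst hrT u g (ξ ω) i - g i) := by
    funext i
    ring
  have ho := hopt ω
  rw [hgd] at ho
  obtain ⟨Θhat, h1, h2, h3⟩ := det_main g _ B₁ D₂₁ D₁₁ hd Θ₀ hΘ₀ hεN (Θt ω) (α ω) ho
  refine ⟨Θhat, h1, h2, h3.trans (le_of_eq ?_)⟩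
  rw [hεdef]
  ring
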